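/- Let K be a number field of degree 6 over ℚ that is Galois over ℚ with cyclic Galois group, and suppose K contains elements α and β with α³ = 21α − 35 and β² = −7 (so K is the sextic cyclic CM field ℚ(α, √−7) of conductor 63, with class number 3 and whose cubic subfield has class number 3). Then there exist a generator σ of Gal(K/ℚ), a nonzero ideal 𝔠 of 𝒪_K, and a Shimura ideal character of type (σ, 𝔠). -/

import Mathlib

open NumberField

/-- The action of `τ ∈ Gal(K/ℚ)` on ideals of the ring of integers of `K`,
via the restriction of `τ` to `𝓞 K`. -/
noncomputable def idealConj {K : Type*} [Field K] [NumberField K] (τ : K ≃ₐ[ℚ] K)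
    (I : Ideal (𝓞 K)) : Ideal (𝓞 K) :=
  Ideal.map (galRestrict ℤ ℚ K (𝓞 K) τ) I

/-- The cubic subfield `F` of `K`: the fixed field of `ρ = σ³`. -/
noncomputable def cubicFixedField {K : Type*} [Field K] [NumberField K] (σ : K ≃ₐ[ℚ] K) :
    IntermediateField ℚ K :=
  IntermediateField.fixedField (Subgroup.zpowers (σ ^ 3))

/-- A *Shimura ideal character of type `(σ, 𝔠)`* on a sextic cyclic CM field `K` with
`σ` a generator of `Gal(K/ℚ)`, `ρ = σ³`, and `F` the cubic subfield (fixed field of `ρ`):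
a map `ψ` from the nonzero ideals of `𝓞 K` coprime to `𝔠` to the nonzero elements of `K`
such that
(i)   `ψ (I * J) = ψ I * ψ J`;
(ii)  `ψ (s 𝓞 K) = s • σ⁴ s • σ⁵ s` whenever `s ≡ 1 mod 𝔠`;
(iii) for a prime `𝔭` of `𝓞 F` unramified in `K` (coprime to `𝔠`), `ψ (𝔭 𝓞 K) = N 𝔭`
      if `𝔭` splits in `K` and `ψ (𝔭 𝓞 K) = -N 𝔭` if `𝔭 𝓞 K` is prime;
(iv)  `ψ I * ρ (ψ I) = N I` and `ψ I • 𝓞 K = I • σ⁴ I • σ⁵ I` as (fractional) ideals;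
(v)   `ψ (σ I) = σ (ψ I)`.
Here the absolute norm `N` of an ideal is the cardinality of the corresponding quotient. -/
noncomputable def IsShimuraIdealChar {K : Type*} [Field K] [NumberField K]
    (σ : K ≃ₐ[ℚ] K) (𝔠 : Ideal (𝓞 K)) (ψ : Ideal (𝓞 K) → K) : Prop :=
  -- ψ takes nonzero values on nonzero ideals coprime to 𝔠
  (∀ I : Ideal (𝓞 K), I ≠ ⊥ → IsCoprime I 𝔠 → ψ I ≠ 0) ∧
  -- (i) multiplicativity
  (∀ I J : Ideal (𝓞 K), I ≠ ⊥ → J ≠ ⊥ → IsCoprime I 𝔠 → IsCoprime J 𝔠 →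
    ψ (I * J) = ψ I * ψ J) ∧
  -- (ii) value on principal ideals generated by `s ≡ 1 mod 𝔠`
  (∀ s : 𝓞 K, IsCoprime (Ideal.span {s}) 𝔠 → s - 1 ∈ 𝔠 →
    ψ (Ideal.span {s}) = (s : K) * (σ ^ 4) (s : K) * (σ ^ 5) (s : K)) ∧
  -- (iii) value on primes of the cubic subfield `F` unramified in `K`: such a prime either
  -- splits (`𝔭 𝓞 K` is a product of two distinct primes) or is inert (`𝔭 𝓞 K` is prime)
  (∀ 𝔭 : Ideal (𝓞 (cubicFixedField σ)), 𝔭.IsPrime → 𝔭 ≠ ⊥ →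
    IsCoprime (Ideal.map (algebraMap (𝓞 (cubicFixedField σ)) (𝓞 K)) 𝔭) 𝔠 →
    ((∃ Q₁ Q₂ : Ideal (𝓞 K), Q₁.IsPrime ∧ Q₂.IsPrime ∧ Q₁ ≠ Q₂ ∧
        Ideal.map (algebraMap (𝓞 (cubicFixedField σ)) (𝓞 K)) 𝔭 = Q₁ * Q₂) →
      ψ (Ideal.map (algebraMap (𝓞 (cubicFixedField σ)) (𝓞 K)) 𝔭)
        = (Nat.card (𝓞 (cubicFixedField σ) ⧸ 𝔭) : K)) ∧
    ((Ideal.map (algebraMap (𝓞 (cubicFixedField σ)) (𝓞 K)) 𝔭).IsPrime →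
      ψ (Ideal.map (algebraMap (𝓞 (cubicFixedField σ)) (𝓞 K)) 𝔭)
        = -(Nat.card (𝓞 (cubicFixedField σ) ⧸ 𝔭) : K))) ∧
  -- (iv) norm relation and ideal generation
  (∀ I : Ideal (𝓞 K), I ≠ ⊥ → IsCoprime I 𝔠 →
    ψ I * (σ ^ 3) (ψ I) = (Nat.card (𝓞 K ⧸ I) : K) ∧
    FractionalIdeal.spanSingleton (nonZeroDivisors (𝓞 K)) (ψ I)
      = ((I * idealConj (σ ^ 4) I * idealConj (σ ^ 5) I : Ideal (𝓞 K)) :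
          FractionalIdeal (nonZeroDivisors (𝓞 K)) K)) ∧
  -- (v) Galois equivariance with respect to σ
  (∀ I : Ideal (𝓞 K), I ≠ ⊥ → IsCoprime I 𝔠 → ψ (idealConj σ I) = σ (ψ I))

set_option linter.style.haveILetI false
set_option linter.unusedSectionVars false

section Pieces
open Pointwise
structure Dat {K : Type*} [Field K] [NumberField K] (σ : K ≃ₐ[ℚ] K) (α β : K) : Prop where
  gen : ∀ τ : K ≃ₐ[ℚ] K, τ ∈ Subgroup.zpowers σ
  ord : orderOf σ = 6
  hα : α ^ 3 = 21 * α - 35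
  hβ : β ^ 2 = -7
  sβ : σ β = -β
  sα : σ (σ (σ α)) = α
  e1 : α + σ α + σ (σ α) = 0
  e2 : α * σ α + α * σ (σ α) + σ α * σ (σ α) = -21
  e3 : α * σ α * σ (σ α) = -35

section
variable {K : Type*} [Field K] [NumberField K]

lemma rat_of_fix [IsGalois ℚ K] (σ : K ≃ₐ[ℚ] K) (gen : ∀ τ : K ≃ₐ[ℚ] K, τ ∈ Subgroup.zpowers σ)
    (x : K) (hx : σ x = x) : ∃ q : ℚ, (q : K) = x := by
  have h : x ∈ Set.range (algebraMap ℚ K) := by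
    rw [IsGalois.mem_range_algebraMap_iff_fixed]
    intro τ
    have hle : Subgroup.zpowers σ ≤ MulAction.stabilizer (K ≃ₐ[ℚ] K) x := by
      rw [Subgroup.zpowers_le]
      exact hx
    exact hle (gen τ)
  obtain ⟨q, hq⟩ := h
  exact ⟨q, by simpa using hq⟩

lemma no_rat_cubic (q : ℚ) : q ^ 3 ≠ 21 * q - 35 := by
  intro h
  have hintegral : IsIntegral ℤ q := by
    refine ⟨Polynomial.X ^ 3 - Polynomial.C 21 * Polynomial.X + Polynomial.C 35, ?_, ?_⟩
    · monicity!
    · simp [h]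
  obtain ⟨n, hn⟩ := IsIntegrallyClosed.isIntegral_iff.mp hintegral
  have hn' : (n : ℚ) = q := by simpa using hn
  subst hn'
  have h' : n ^ 3 = 21 * n - 35 := by exact_mod_cast h
  have h7 : (7 : ℤ) ∣ n := by
    have : (7 : ℤ) ∣ n ^ 3 := ⟨3 * n - 5, by linarith⟩
    exact (by norm_num : Prime (7 : ℤ)).dvd_of_dvd_pow this
  obtain ⟨m, rfl⟩ := h7
  have : 49 * m ^ 3 - 21 * m = -5 := by linarith
  omega

lemma no_rat_sq (q : ℚ) : q ^ 2 ≠ -7 := by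
  intro h
  nlinarith [sq_nonneg q]

theorem exists_dat [IsGalois ℚ K] (hdeg : Module.finrank ℚ K = 6) (hcyc : IsCyclic (K ≃ₐ[ℚ] K))
    (α β : K) (hα : α ^ 3 = 21 * α - 35) (hβ : β ^ 2 = (-7 : K)) :
    ∃ σ : K ≃ₐ[ℚ] K, Dat σ α β := by
  obtain ⟨σ, gen⟩ := hcyc.exists_generator
  refine ⟨σ, ?_⟩
  have ord : orderOf σ = 6 := by
    rw [orderOf_eq_card_of_forall_mem_zpowers gen, IsGalois.card_aut_eq_finrank, hdeg]
  have root : ∀ x : K, x ^ 3 = 21 * x - 35 → (σ x) ^ 3 = 21 * (σ x) - 35 := by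
    intro x hx
    rw [← map_pow, hx, map_sub, map_mul, map_ofNat σ 21, map_ofNat σ 35]
  have nofix : ∀ x : K, x ^ 3 = 21 * x - 35 → σ x ≠ x := by
    intro x hx h
    obtain ⟨q, rfl⟩ := rat_of_fix σ gen x h
    exact no_rat_cubic q (by exact_mod_cast hx)
  have hb : σ α ^ 3 = 21 * σ α - 35 := root _ hα
  have hc : σ (σ α) ^ 3 = 21 * σ (σ α) - 35 := root _ hb
  have hd := root _ hc
  have n1 : σ α ≠ α := nofix _ hα
  have n2 : σ (σ α) ≠ σ α := nofix _ hb
  have q1 : α ^ 2 + α * σ α + (σ α) ^ 2 = 21 := by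
    have := sub_ne_zero.mpr n1
    apply mul_left_cancel₀ this
    linear_combination hb - hα
  have n3 : σ (σ α) ≠ α := by
    intro h
    obtain ⟨q, hq⟩ := rat_of_fix σ gen (-(α + σ α)) (by simp [h, add_comm])
    apply no_rat_cubic q
    have : (q : K) ^ 3 = 21 * q - 35 := by
      rw [hq]; linear_combination (-2 * α - σ α) * q1 + hα
    exact_mod_cast this
  have q2 : (σ α) ^ 2 + σ α * σ (σ α) + (σ (σ α)) ^ 2 = 21 := by
    have := congrArg σ q1
    rw [map_ofNat σ 21] at this
    simpa using this
  have e1 : α + σ α + σ (σ α) = 0 := by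
    have := sub_ne_zero.mpr n3
    apply mul_left_cancel₀ this
    linear_combination q2 - q1
  have e1' : σ α + σ (σ α) + σ (σ (σ α)) = 0 := by
    have := congrArg σ e1
    simpa using this
  have hc' : σ (σ α) = - α - σ α := by linear_combination e1
  refine ⟨gen, ord, hα, hβ, ?_, ?_, e1, ?_, ?_⟩
  · have : (σ β - β) * (σ β + β) = 0 := by
      have : σ β ^ 2 = -7 := by rw [← map_pow, hβ, map_neg, map_ofNat σ 7]
      linear_combination this - hβ
    rcases mul_eq_zero.mp this with h | h
    · obtain ⟨q, rfl⟩ := rat_of_fix σ gen β (sub_eq_zero.mp h)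
      exact absurd (by exact_mod_cast hβ) (no_rat_sq q)
    · linear_combination h
  · linear_combination e1' - e1
  · rw [hc']; linear_combination -q1
  · rw [hc']; linear_combination hα - α * q1

namespace Dat
variable {σ : K ≃ₐ[ℚ] K} {α β : K} (D : Dat σ α β)
include D

lemma pow6 : σ ^ 6 = 1 := by rw [← D.ord]; exact pow_orderOf_eq_one σ

lemma univ_eq [DecidableEq (K ≃ₐ[ℚ] K)] :
    (Finset.univ : Finset (K ≃ₐ[ℚ] K)) = Finset.image (fun i => σ ^ i) (Finset.range 6) := by
  have := IsCyclic.image_range_orderOf (a := σ) D.gen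
  rw [D.ord] at this
  exact this.symm

lemma prod_gal {M : Type*} [CommMonoid M] (f : (K ≃ₐ[ℚ] K) → M) :
    ∏ τ, f τ = f 1 * f σ * f (σ ^ 2) * f (σ ^ 3) * f (σ ^ 4) * f (σ ^ 5) := by
  classical
  rw [D.univ_eq, Finset.prod_image]
  · simp [Finset.prod_range_succ]
  · intro i hi j hj h
    simp only [Finset.coe_range, Set.mem_Iio] at hi hj
    exact pow_injOn_Iio_orderOf (by rw [D.ord]; exact hi) (by rw [D.ord]; exact hj) h

lemma exists_pow (τ : K ≃ₐ[ℚ] K) : ∃ i < 6, τ = σ ^ i := by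
  classical
  have : τ ∈ (Finset.univ : Finset (K ≃ₐ[ℚ] K)) := Finset.mem_univ _
  rw [D.univ_eq] at this
  simpa [eq_comm] using this

end Dat
end

section
variable {K : Type*} [Field K] [NumberField K]

lemma gsmul_span (τ : K ≃ₐ[ℚ] K) (x : 𝓞 K) :
    τ • Ideal.span {x} = Ideal.span {τ • x} := by
  rw [Ideal.smul_closure, Set.smul_set_singleton]

lemma gsmul_coe (τ : K ≃ₐ[ℚ] K) (x : 𝓞 K) : ((τ • x : 𝓞 K) : K) = τ x := rfl

lemma gsmul_natCast (τ : K ≃ₐ[ℚ] K) (n : ℕ) : τ • (n : 𝓞 K) = n := by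
  apply RingOfIntegers.coe_injective
  refine (gsmul_coe τ (n : 𝓞 K)).trans ?_
  simp only [map_natCast]

lemma absNorm_gsmul [IsGalois ℚ K] (τ : K ≃ₐ[ℚ] K) (I : Ideal (𝓞 K)) :
    Ideal.absNorm (τ • I) = Ideal.absNorm I := by
  have h := Ideal.relNorm_smul ℤ τ I
  rw [Ideal.relNorm_int, Ideal.relNorm_int, Ideal.span_singleton_eq_span_singleton] at h
  have := Int.natAbs_eq_iff_associated.mpr h
  simpa using this

/-- CM-type ideal norm. -/
noncomputable def PhiI (σ : K ≃ₐ[ℚ] K) (I : Ideal (𝓞 K)) : Ideal (𝓞 K) :=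
  I * (σ ^ 4) • I * (σ ^ 5) • I

noncomputable def phiE (σ : K ≃ₐ[ℚ] K) (x : 𝓞 K) : 𝓞 K := x * (σ ^ 4) • x * (σ ^ 5) • x

def HG (σ : K ≃ₐ[ℚ] K) (I : Ideal (𝓞 K)) : Prop :=
  ∃ γ : 𝓞 K, Ideal.span {γ} = PhiI σ I ∧ γ * (σ ^ 3) • γ = (Ideal.absNorm I : 𝓞 K)

lemma PhiI_span (σ : K ≃ₐ[ℚ] K) (x : 𝓞 K) : PhiI σ (Ideal.span {x}) = Ideal.span {phiE σ x} := by
  simp only [PhiI, phiE, gsmul_span, Ideal.span_singleton_mul_span_singleton]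

lemma PhiI_mul (σ : K ≃ₐ[ℚ] K) (I J : Ideal (𝓞 K)) : PhiI σ (I * J) = PhiI σ I * PhiI σ J := by
  simp only [PhiI, smul_mul']; ring

lemma PhiI_one (σ : K ≃ₐ[ℚ] K) : PhiI σ (1 : Ideal (𝓞 K)) = 1 := by
  simp only [PhiI, smul_one]; ring

lemma PhiI_pow (σ : K ≃ₐ[ℚ] K) (I : Ideal (𝓞 K)) (n : ℕ) : PhiI σ (I ^ n) = PhiI σ I ^ n := by
  induction n with
  | zero => rw [pow_zero, pow_zero, PhiI_one]
  | succ n ih => rw [pow_succ, pow_succ, PhiI_mul, ih]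

lemma gsmul_ne_bot (τ : K ≃ₐ[ℚ] K) {I : Ideal (𝓞 K)} (h : I ≠ ⊥) : τ • I ≠ ⊥ := by
  intro h'
  apply h
  rw [← inv_smul_smul τ I, h', Ideal.smul_bot]

lemma PhiI_ne_bot (σ : K ≃ₐ[ℚ] K) {I : Ideal (𝓞 K)} (h : I ≠ ⊥) : PhiI σ I ≠ ⊥ := by
  simp only [PhiI, ← Ideal.zero_eq_bot]
  exact mul_ne_zero (mul_ne_zero h (gsmul_ne_bot _ h)) (gsmul_ne_bot _ h)

lemma smul_PhiI (σ : K ≃ₐ[ℚ] K) (I : Ideal (𝓞 K)) : σ • PhiI σ I = PhiI σ (σ • I) := by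
  simp only [PhiI, smul_mul', smul_smul, pow_succ, pow_zero, one_mul, mul_assoc]

theorem ideal_pow_inj {I J : Ideal (𝓞 K)} {n : ℕ} (hn : n ≠ 0) (h : I ^ n = J ^ n) : I = J := by
  by_cases hI : I = 0
  · subst hI
    rw [zero_pow hn] at h
    exact (pow_eq_zero_iff hn).mp h.symm |>.symm
  · have hJ : J ≠ 0 := by
      rintro rfl
      rw [zero_pow hn] at h
      exact hI ((pow_eq_zero_iff hn).mp h)
    have h2 := congrArg UniqueFactorizationMonoid.normalizedFactors h
    rw [UniqueFactorizationMonoid.normalizedFactors_pow,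
      UniqueFactorizationMonoid.normalizedFactors_pow] at h2
    have h3 := nsmul_right_injective hn h2
    exact associated_iff_eq.mp ((UniqueFactorizationMonoid.associated_iff_normalizedFactors_eq_normalizedFactors hI hJ).mpr h3)

lemma exists_pow_principal {I : Ideal (𝓞 K)} (hI : I ≠ ⊥) : ∃ h : ℕ, h ≠ 0 ∧ (I ^ h).IsPrincipal := by
  have hI0 : I ∈ nonZeroDivisors (Ideal (𝓞 K)) := mem_nonZeroDivisors_of_ne_zero hI
  obtain ⟨h, hh, h1⟩ : ∃ h : ℕ, h ≠ 0 ∧ (ClassGroup.mk0 ⟨I, hI0⟩ : ClassGroup (𝓞 K)) ^ h = 1 :=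
    ⟨_, Fintype.card_ne_zero, pow_card_eq_one⟩
  refine ⟨h, hh, ?_⟩
  rw [← map_pow] at h1
  have hm : I ^ h ∈ nonZeroDivisors (Ideal (𝓞 K)) := pow_mem hI0 h
  have e : (⟨I, hI0⟩ : nonZeroDivisors (Ideal (𝓞 K))) ^ h = ⟨I ^ h, hm⟩ := Subtype.ext rfl
  rw [e] at h1
  exact (ClassGroup.mk0_eq_one_iff hm).mp h1

namespace Dat
variable {σ : K ≃ₐ[ℚ] K} {α β : K} (D : Dat σ α β)

lemma HG_mul {I J : Ideal (𝓞 K)} (hI : HG σ I) (hJ : HG σ J) : HG σ (I * J) := by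
  obtain ⟨γ, h1, h2⟩ := hI
  obtain ⟨δ, h3, h4⟩ := hJ
  refine ⟨γ * δ, ?_, ?_⟩
  · rw [PhiI_mul, ← h1, ← h3, Ideal.span_singleton_mul_span_singleton]
  · rw [smul_mul', map_mul, Nat.cast_mul, ← h2, ← h4]; ring

lemma HG_cancel {I J : Ideal (𝓞 K)} (hJ0 : J ≠ ⊥) (hIJ : HG σ (I * J)) (hJ : HG σ J) :
    HG σ I := by
  obtain ⟨γ, h1, h2⟩ := hIJ
  obtain ⟨δ, h3, h4⟩ := hJ
  rw [PhiI_mul] at h1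
  have hdvd : δ ∣ γ := by
    rw [← Ideal.mem_span_singleton, ← Ideal.span_singleton_le_iff_mem, h1, h3]
    exact Ideal.dvd_iff_le.mp (dvd_mul_left _ _)
  obtain ⟨ε, rfl⟩ := hdvd
  have hP := PhiI_ne_bot σ hJ0
  refine ⟨ε, ?_, ?_⟩
  · rw [← Ideal.span_singleton_mul_span_singleton, h3, mul_comm] at h1
    exact mul_right_cancel₀ hP h1
  · have hN : (Ideal.absNorm J : 𝓞 K) ≠ 0 := by
      rw [Nat.cast_ne_zero, Ne, Ideal.absNorm_eq_zero_iff]; exact hJ0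
    apply mul_right_cancel₀ hN
    rw [← Nat.cast_mul, ← map_mul, ← h2, ← h4, smul_mul']; ring

lemma HG_smul [IsGalois ℚ K] {I : Ideal (𝓞 K)} (hI : HG σ I) : HG σ (σ • I) := by
  obtain ⟨γ, h1, h2⟩ := hI
  refine ⟨σ • γ, ?_, ?_⟩
  · rw [← gsmul_span, h1, smul_PhiI]
  · rw [absNorm_gsmul, ← gsmul_natCast σ, ← h2, smul_mul', smul_smul, smul_smul, ← pow_succ, ← pow_succ']

lemma HG_smul_pow [IsGalois ℚ K] {I : Ideal (𝓞 K)} (hI : HG σ I) (n : ℕ) : HG σ ((σ ^ n) • I) := by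
  induction n with
  | zero => simpa using hI
  | succ n ih => rw [pow_succ', mul_smul]; exact HG_smul ih

include D

/-- `σ ^ 3` is complex conjugation in every embedding. -/
lemma conj_eq [IsGalois ℚ K] (φ : K →+* ℂ) (x : K) : star (φ x) = φ ((σ ^ 3) x) := by
  obtain ⟨τ, hτ⟩ := ComplexEmbedding.exists_comp_symm_eq_of_comp_eq (k := ℚ) φ
    (ComplexEmbedding.conjugate φ) (RingHom.ext fun q => by simp)
  have hτ' : ∀ y, φ (τ.symm y) = star (φ y) := fun y => by
    have := RingHom.congr_fun hτ y
    simpa using this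
  obtain ⟨i, hi, hτi⟩ := D.exists_pow τ.symm
  rw [hτi] at hτ'
  have hsq : σ ^ (i + i) = 1 := by
    ext y
    apply φ.injective
    rw [pow_add, AlgEquiv.mul_apply, hτ', hτ', star_star]; rfl
  have h6 := orderOf_dvd_of_pow_eq_one hsq
  rw [D.ord] at h6
  have : i = 0 ∨ i = 3 := by omega
  rcases this with rfl | rfl
  · exfalso
    have hb := hτ' β
    simp only [pow_zero, AlgEquiv.one_apply] at hb
    obtain ⟨r, hr⟩ := Complex.conj_eq_iff_real.mp hb.symm
    have h7 : φ β ^ 2 = -7 := by rw [← map_pow, D.hβ, map_neg, map_ofNat φ 7]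
    rw [hr] at h7
    have h7' : r ^ 2 = -7 := by exact_mod_cast h7
    nlinarith [sq_nonneg r]
  · exact (hτ' x).symm

lemma prod_all (x : 𝓞 K) : phiE σ x * (σ ^ 3) • phiE σ x = ∏ τ : K ≃ₐ[ℚ] K, τ • x := by
  rw [D.prod_gal]
  simp only [phiE, smul_mul', smul_smul, ← pow_add]
  rw [show σ ^ (3 + 4) = σ from by rw [show 3 + 4 = 6 + 1 from rfl, pow_add, D.pow6]; simp,
   show σ ^ (3 + 5) = σ ^ 2 from by rw [show 3 + 5 = 6 + 2 from rfl, pow_add, D.pow6]; simp]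
  rw [one_smul]
  ring

lemma prod_norm [IsGalois ℚ K] (x : 𝓞 K) :
    ∏ τ : K ≃ₐ[ℚ] K, τ • x = ((Algebra.norm ℤ x : ℤ) : 𝓞 K) := by
  apply RingOfIntegers.coe_injective
  rw [map_prod]
  have := Algebra.norm_eq_prod_automorphisms ℚ (x : K)
  rw [← Algebra.coe_norm_int] at this
  simp only [map_intCast] at this
  simp only [map_intCast]
  rw [this]; rfl

lemma norm_nonneg [IsGalois ℚ K] (x : 𝓞 K) : 0 ≤ Algebra.norm ℤ x := by
  have h := D.prod_norm x
  rw [← D.prod_all] at h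
  obtain ⟨φ⟩ := (inferInstance : Nonempty (K →+* ℂ))
  have h2 := congrArg (fun y : 𝓞 K => φ (y : K)) h
  simp only [map_mul, gsmul_coe, map_intCast] at h2
  have h3 := D.conj_eq φ (phiE σ x : K)
  rw [← h3, Complex.star_def, Complex.mul_conj] at h2
  have h4 : Complex.normSq (φ (phiE σ x : K)) = ((Algebra.norm ℤ x : ℤ) : ℝ) := by exact_mod_cast h2
  have := Complex.normSq_nonneg (φ (phiE σ x : K))
  rw [h4] at this
  exact_mod_cast this

lemma absNorm_span_cast [IsGalois ℚ K] (x : 𝓞 K) :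
    phiE σ x * (σ ^ 3) • phiE σ x = (Ideal.absNorm (Ideal.span {x}) : 𝓞 K) := by
  rw [D.prod_all, D.prod_norm, Ideal.absNorm_span_singleton]
  conv_lhs => rw [← Int.natAbs_of_nonneg (D.norm_nonneg x)]
  simp

lemma HG_span [IsGalois ℚ K] (x : 𝓞 K) : HG σ (Ideal.span {x}) :=
  ⟨phiE σ x, (PhiI_span σ x).symm, D.absNorm_span_cast x⟩

lemma HG_class [IsGalois ℚ K] {I J : Ideal (𝓞 K)} {x y : 𝓞 K} (hx : x ≠ 0)
    (h : Ideal.span {x} * I = Ideal.span {y} * J) (hJ : HG σ J) : HG σ I := by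
  refine HG_cancel (J := Ideal.span {x}) ?_ ?_ (D.HG_span x)
  · rwa [Ne, Ideal.span_singleton_eq_bot]
  · rw [mul_comm, h]; exact HG_mul (D.HG_span y) hJ

lemma PhiI_mul_conj [IsGalois ℚ K] {I : Ideal (𝓞 K)} (hI : I ≠ ⊥) :
    PhiI σ I * (σ ^ 3) • PhiI σ I = Ideal.span {(Ideal.absNorm I : 𝓞 K)} := by
  obtain ⟨h, hh, hp⟩ := exists_pow_principal hI
  obtain ⟨x, hx⟩ := hp
  change I ^ h = Ideal.span {x} at hx
  apply ideal_pow_inj hh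
  have e1 : (PhiI σ I * (σ ^ 3) • PhiI σ I) ^ h = PhiI σ (I ^ h) * (σ ^ 3) • PhiI σ (I ^ h) := by
    rw [mul_pow, PhiI_pow, smul_pow']
  have e2 : (Ideal.absNorm (I ^ h) : 𝓞 K) = (Ideal.absNorm I : 𝓞 K) ^ h := by
    rw [map_pow, Nat.cast_pow]
  rw [e1, Ideal.span_singleton_pow, ← e2, hx, PhiI_span, gsmul_span,
    Ideal.span_singleton_mul_span_singleton, D.absNorm_span_cast]

lemma HG_stable [IsGalois ℚ K] {Q : Ideal (𝓞 K)} (hQ : Q ≠ ⊥) (hst : (σ ^ 3) • Q = Q) (γ : 𝓞 K)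
    (hγ : Ideal.span {γ} ^ 2 = Ideal.span {(Ideal.absNorm Q : 𝓞 K)})
    (hγ2 : γ * (σ ^ 3) • γ = (Ideal.absNorm Q : 𝓞 K)) : HG σ Q := by
  refine ⟨γ, ?_, hγ2⟩
  have h := D.PhiI_mul_conj hQ
  apply ideal_pow_inj two_ne_zero
  rw [hγ, ← h, sq]
  congr 1
  simp only [PhiI, smul_mul', smul_smul, ← pow_add, hst]
  rw [add_comm 3 4, add_comm 3 5, pow_add, pow_add, mul_smul, mul_smul, hst]

lemma HG_of_primes [IsGalois ℚ K] {J : Ideal (𝓞 K)}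
    (h : ∀ Q : Ideal (𝓞 K), Q.IsPrime → Q ≠ ⊥ → Q ∣ J → HG σ Q) : HG σ J := by
  revert h
  have hspan := D.HG_span
  clear D
  refine UniqueFactorizationMonoid.induction_on_prime
    (P := fun J => (∀ Q : Ideal (𝓞 K), Q.IsPrime → Q ≠ ⊥ → Q ∣ J → HG σ Q) → HG σ J) J ?_ ?_ ?_
  · intro _
    simpa using hspan 0
  · intro x hx _
    rw [isUnit_iff_eq_one.mp hx]
    simpa using hspan 1
  · intro a p ha hp ih h
    refine HG_mul (h p (Ideal.isPrime_of_prime hp) hp.ne_zero (dvd_mul_right _ _)) (ih ?_)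
    intro Q hQ hQ0 hdvd
    exact h Q hQ hQ0 (hdvd.mul_left _)

end Dat
end

lemma nsq7 : ¬ IsSquare ((-1 : ℤ) : ZMod 7) := by decide

lemma isSquare_neg_seven_iff {k : Type*} [Field k] [Fintype k] (h2 : ringChar k ≠ 2)
    (h7 : (7 : k) ≠ 0) : IsSquare (-7 : k) ↔ IsSquare ((Fintype.card k : ℕ) : ZMod 7) := by
  classical
  haveI : Fact (Nat.Prime 7) := ⟨by norm_num⟩
  have hc7 : ringChar k ≠ 7 := by
    intro h
    apply h7
    have := ringChar.Nat.cast_ringChar (R := k)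
    rw [h] at this
    exact_mod_cast this
  have hodd : Fintype.card k % 2 = 1 := FiniteField.odd_card_of_char_ne_two h2
  have h1 := quadraticChar_odd_prime (F := k) h2 (p := 7) (by norm_num) hc7
  have h3 := quadraticChar_neg_one (F := k) h2
  have hcard : ((Fintype.card k : ℕ) : ZMod 7) ≠ 0 := by
    intro h
    rw [ZMod.natCast_eq_zero_iff] at h
    obtain ⟨p, hp⟩ := CharP.exists k
    haveI := hp
    obtain ⟨n, hpp, hn⟩ := FiniteField.card k p
    rw [hn] at h
    have : 7 = p := (Nat.prime_dvd_prime_iff_eq (by norm_num) hpp).mp (Nat.Prime.dvd_of_dvd_pow (by norm_num) h)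
    subst this
    exact hc7 (ringChar.eq k 7)
  have h4 : quadraticChar k (-7) = quadraticChar (ZMod 7) (Fintype.card k : ℕ) := by
    rw [show (-7 : k) = (-1) * ((7 : ℕ) : k) by push_cast; ring, map_mul, h1, h3, map_mul]
    have h4 : Fintype.card k % 4 = 1 ∨ Fintype.card k % 4 = 3 := by omega
    rcases h4 with h | h
    · rw [ZMod.χ₄_nat_one_mod_four h]; simp
    · rw [ZMod.χ₄_nat_three_mod_four h]
      have : quadraticChar (ZMod 7) ((-1 : ℤ) : ZMod 7) = -1 := by
        rw [quadraticChar_neg_one_iff_not_isSquare]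
        exact nsq7
      rw [this]; ring
  have h5 : (-7 : k) ≠ 0 := neg_ne_zero.mpr h7
  rw [← quadraticChar_one_iff_isSquare h5, ← quadraticChar_one_iff_isSquare hcard, h4]

section
variable {K : Type*} [Field K] [NumberField K]

lemma int_rep {Q : Ideal (𝓞 K)} {p : ℕ} (hp : p.Prime) (hN : Ideal.absNorm Q = p) (x : 𝓞 K) :
    ∃ n : ℤ, x - n ∈ Q := by
  have hcard : Nat.card (𝓞 K ⧸ Q) = p := by
    rw [← hN, Ideal.absNorm_apply, Submodule.cardQuot_apply]
  haveI : Finite (𝓞 K ⧸ Q) := Nat.finite_of_card_ne_zero (by rw [hcard]; exact hp.ne_zero)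
  letI := Fintype.ofFinite (𝓞 K ⧸ Q)
  have e := ZMod.ringEquivOfPrime (𝓞 K ⧸ Q) hp (by rw [← Nat.card_eq_fintype_card, hcard])
  obtain ⟨z, hz⟩ := e.surjective (Ideal.Quotient.mk Q x)
  haveI : NeZero p := ⟨hp.ne_zero⟩
  refine ⟨z.val, ?_⟩
  rw [← Ideal.Quotient.eq, ← hz]
  conv_lhs => rw [← ZMod.natCast_zmod_val z, map_natCast]
  rw [Int.cast_natCast, map_natCast]

lemma coprime_not_mem {Q : Ideal (𝓞 K)} (hQ : Q ≠ ⊤) {a b : ℤ} (h : IsCoprime a b)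
    (ha : (a : 𝓞 K) ∈ Q) : (b : 𝓞 K) ∉ Q := by
  intro hb
  obtain ⟨u, v, huv⟩ := h
  apply hQ
  rw [Ideal.eq_top_iff_one]
  have : ((u * a + v * b : ℤ) : 𝓞 K) ∈ Q := by
    push_cast
    exact Q.add_mem (Q.mul_mem_left _ ha) (Q.mul_mem_left _ hb)
  rw [huv] at this
  simpa using this

lemma dvd_of_mem {Q : Ideal (𝓞 K)} (hQ : Q ≠ ⊤) {p : ℕ} (hp : p.Prime) (hpQ : (p : 𝓞 K) ∈ Q)
    {n : ℤ} (hn : (n : 𝓞 K) ∈ Q) : (p : ℤ) ∣ n := by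
  by_contra h
  have := (Nat.prime_iff_prime_int.mp hp).coprime_iff_not_dvd.mpr h
  exact coprime_not_mem hQ this (by exact_mod_cast hpQ) hn

lemma absNorm_prime_pow {Q : Ideal (𝓞 K)} (hQ : Q.IsPrime) {p : ℕ} (hp : p.Prime)
    (hpQ : (p : 𝓞 K) ∈ Q) : ∃ f : ℕ, f ≠ 0 ∧ Ideal.absNorm Q = p ^ f := by
  have h1 : Ideal.absNorm Q ∣ Ideal.absNorm (Ideal.span {(p : 𝓞 K)}) :=
    Ideal.absNorm_dvd_absNorm_of_le ((Ideal.span_singleton_le_iff_mem _).mpr hpQ)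
  have h2 : Ideal.absNorm (Ideal.span {(p : 𝓞 K)}) = p ^ (Module.finrank ℤ (𝓞 K)) := by
    rw [Ideal.absNorm_span_singleton]
    have : (p : 𝓞 K) = algebraMap ℤ (𝓞 K) p := by simp
    rw [this, Algebra.norm_algebraMap]
    simp [Int.natAbs_pow]
  rw [h2] at h1
  obtain ⟨f, _, hf⟩ := (Nat.dvd_prime_pow hp).mp h1
  refine ⟨f, ?_, hf⟩
  rintro rfl
  rw [pow_zero, Ideal.absNorm_eq_one_iff] at hf
  exact hQ.ne_top hf

lemma ne_bot_of_mem {Q : Ideal (𝓞 K)} {p : ℕ} (hp : p.Prime) (hpQ : (p : 𝓞 K) ∈ Q) : Q ≠ ⊥ := by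
  rintro rfl
  rw [Ideal.mem_bot] at hpQ
  exact hp.ne_zero (by exact_mod_cast hpQ)

lemma liesOver_of_mem {Q : Ideal (𝓞 K)} (hQ : Q.IsPrime) {p : ℕ} (hp : p.Prime)
    (hpQ : (p : 𝓞 K) ∈ Q) : Ideal.span {(p : ℤ)} = Q.under ℤ := by
  ext n
  rw [Ideal.mem_span_singleton, Ideal.under_def, Ideal.mem_comap]
  constructor
  · rintro ⟨m, rfl⟩
    rw [map_mul]
    apply Ideal.mul_mem_right
    simpa using hpQ
  · intro h
    exact dvd_of_mem hQ.ne_top hp hpQ (by simpa using h)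

lemma exists_int {x : K} (h : IsIntegral ℤ x) : ∃ b : 𝓞 K, (b : K) = x := ⟨⟨x, h⟩, rfl⟩

def good (σ : K ≃ₐ[ℚ] K) (p : ℕ) : Prop :=
  ∀ Q : Ideal (𝓞 K), Q.IsPrime → (p : 𝓞 K) ∈ Q → HG σ Q

namespace Dat
variable {σ : K ≃ₐ[ℚ] K} {α β : K} (D : Dat σ α β)
include D

lemma exists_beta : ∃ b : 𝓞 K, (b : K) = β ∧ b ^ 2 = -7 ∧ σ • b = -b := by
  have hi : IsIntegral ℤ β := by
    refine ⟨Polynomial.X ^ 2 + Polynomial.C 7, ?_, ?_⟩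
    · monicity!
    · simp [D.hβ]
  obtain ⟨b, hb⟩ := exists_int hi
  have hb' : algebraMap (𝓞 K) K b = β := hb
  refine ⟨b, hb, ?_, ?_⟩
  · apply RingOfIntegers.coe_injective
    rw [map_pow, map_neg, map_ofNat (algebraMap (𝓞 K) K) 7, hb']
    exact D.hβ
  · apply RingOfIntegers.coe_injective
    refine (gsmul_coe ..).trans ?_
    rw [map_neg, hb, hb']
    exact D.sβ

lemma good_nonsplit [IsGalois ℚ K] {p : ℕ} (hp : p.Prime) (h7 : p % 7 = 3 ∨ p % 7 = 5 ∨ p % 7 = 6) :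
    good σ p := by
  intro Q hQ hpQ
  have hQ0 := ne_bot_of_mem hp hpQ
  haveI := hQ.isMaximal hQ0
  obtain ⟨f, hf0, hf⟩ := absNorm_prime_pow hQ hp hpQ
  obtain ⟨b, -, hb2, hσb⟩ := D.exists_beta
  have hp2 : p ≠ 2 := by rintro rfl; omega
  have hp7 : p ≠ 7 := by rintro rfl; omega
  have hns : ¬ IsSquare ((p : ℕ) : ZMod 7) := by
    have : ((p : ℕ) : ZMod 7) = ((p % 7 : ℕ) : ZMod 7) := by simp
    rw [this]
    rcases h7 with h | h | h <;> rw [h] <;> decide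
  haveI : Fact p.Prime := ⟨hp⟩
  have hcop : ∀ n : ℕ, n.Prime → p ≠ n → (n : 𝓞 K) ∉ Q := by
    intro n hn hpn hmem
    have := dvd_of_mem hQ.ne_top hp hpQ (n := n) (by exact_mod_cast hmem)
    have := Int.natCast_dvd_natCast.mp this
    exact hpn ((Nat.prime_dvd_prime_iff_eq hp hn).mp this)
  -- f is even
  have hfe : Even f := by
    letI := Ideal.Quotient.field Q
    haveI : Finite (𝓞 K ⧸ Q) := Ideal.finiteQuotientOfFreeOfNeBot Q hQ0
    letI := Fintype.ofFinite (𝓞 K ⧸ Q)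
    have hcp : ((p : ℕ) : 𝓞 K ⧸ Q) = 0 := by
      have := (Ideal.Quotient.eq_zero_iff_mem (I := Q)).mpr hpQ
      simpa using this
    have hrc : ringChar (𝓞 K ⧸ Q) = p := by
      have h := ringChar.dvd hcp
      rcases (Nat.dvd_prime hp).mp h with h | h
      · exact absurd h (CharP.ringChar_ne_one)
      · exact h
    have h7' : (7 : 𝓞 K ⧸ Q) ≠ 0 := by
      intro h
      apply hcop 7 (by norm_num) hp7
      rw [← Ideal.Quotient.eq_zero_iff_mem, map_natCast]
      exact_mod_cast h
    have hsq : IsSquare (-7 : 𝓞 K ⧸ Q) := by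
      refine ⟨Ideal.Quotient.mk Q b, ?_⟩
      rw [← map_mul, ← sq, hb2, map_neg, map_ofNat (Ideal.Quotient.mk Q) 7]
    rw [isSquare_neg_seven_iff (by rw [hrc]; exact hp2) h7'] at hsq
    have hcard : Fintype.card (𝓞 K ⧸ Q) = p ^ f := by
      rw [← hf, Ideal.absNorm_apply, Submodule.cardQuot_apply, Nat.card_eq_fintype_card]
    rw [hcard] at hsq
    by_contra hodd
    rw [Nat.not_even_iff_odd] at hodd
    obtain ⟨m, rfl⟩ := hodd
    apply hns
    push_cast at hsq
    rw [pow_succ, mul_comm 2 m, pow_mul] at hsq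
    haveI : Fact (Nat.Prime 7) := ⟨by norm_num⟩
    have hpz : ((p : ℕ) : ZMod 7) ^ m ≠ 0 := by
      apply pow_ne_zero
      intro h
      exact hns (by rw [h]; exact ⟨0, by simp⟩)
    obtain ⟨r, hr⟩ := hsq
    refine ⟨r / ((p : ℕ) : ZMod 7) ^ m, ?_⟩
    field_simp
    rw [← sq] at hr
    rw [← hr]; ring
  -- Frobenius
  haveI : Finite (𝓞 K ⧸ Q) := Ideal.finiteQuotientOfFreeOfNeBot Q hQ0
  obtain ⟨τ, hτ⟩ := IsArithFrobAt.exists_of_isInvariant ℤ (K ≃ₐ[ℚ] K) Q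
  have hst : τ • Q = Q := hτ.mem_stabilizer
  have hfr := hτ b
  rw [← liesOver_of_mem hQ hp hpQ] at hfr
  have hcz : Nat.card (ℤ ⧸ Ideal.span {(p : ℤ)}) = p := by
    rw [Nat.card_congr (Int.quotientSpanNatEquivZMod p).toEquiv, Nat.card_zmod]
  rw [hcz] at hfr
  have heul : ((-7 : ℤ) : 𝓞 K) ^ (p / 2) + 1 ∈ Q := by
    have hne : (-7 : ZMod p) ≠ 0 := by
      rw [neg_ne_zero]
      intro h
      have : ((7 : ℕ) : ZMod p) = 0 := by exact_mod_cast h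
      rw [ZMod.natCast_eq_zero_iff] at this
      exact hp7 ((Nat.prime_dvd_prime_iff_eq hp (by norm_num)).mp this)
    have hnsq : ¬ IsSquare (-7 : ZMod p) := by
      rw [isSquare_neg_seven_iff, ZMod.card]
      · exact hns
      · rw [ZMod.ringChar_zmod_n]; exact hp2
      · exact neg_ne_zero.mp hne
    have h1 : (-7 : ZMod p) ^ (p / 2) = -1 := by
      rcases ZMod.pow_div_two_eq_neg_one_or_one p hne with h | h
      · exact absurd ((ZMod.euler_criterion p hne).mpr h) hnsq
      · exact h
    have h2 : (((-7 : ℤ) ^ (p / 2) + 1 : ℤ) : ZMod p) = 0 := by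
      push_cast
      rw [h1]; ring
    rw [ZMod.intCast_zmod_eq_zero_iff_dvd] at h2
    obtain ⟨c, hc⟩ := h2
    have : (((-7 : ℤ) ^ (p / 2) + 1 : ℤ) : 𝓞 K) ∈ Q := by
      rw [hc]
      push_cast
      exact Q.mul_mem_right _ hpQ
    simpa using this
  have hbp : b ^ p = ((-7 : ℤ) : 𝓞 K) ^ (p / 2) * b := by
    have : p = 2 * (p / 2) + 1 := by
      have := hp.eq_two_or_odd
      omega
    conv_lhs => rw [this, pow_succ, pow_mul, hb2]
    simp
  have hsum : τ • b + b ∈ Q := by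
    have h1 : (MulSemiringAction.toAlgHom ℤ (𝓞 K) τ) b = τ • b := rfl
    rw [h1, hbp] at hfr
    have := Q.add_mem hfr (Q.mul_mem_right b heul)
    convert this using 1
    ring
  obtain ⟨i, hi, rfl⟩ := D.exists_pow τ
  have hb0 : b + b ∉ Q := by
    intro h
    have h1 : ((2 : ℕ) : 𝓞 K) * b ∈ Q := by convert h using 1; push_cast; ring
    rcases hQ.mem_or_mem h1 with h | h
    · exact hcop 2 (by norm_num) hp2 h
    · apply hcop 7 (by norm_num) hp7
      have := Q.mul_mem_left (-b) h
      convert this using 1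
      push_cast
      linear_combination hb2
  have h2b : (σ ^ 2) • b = b := by rw [pow_succ, pow_one, mul_smul, hσb, smul_neg, hσb, neg_neg]
  have hst3 : (σ ^ 3) • Q = Q := by
    have h6 := D.pow6
    interval_cases i
    · simp only [pow_zero, one_smul] at hsum; exact absurd hsum hb0
    · rw [pow_one] at hst
      rw [show σ ^ 3 = σ * σ * σ by rw [pow_succ, pow_succ, pow_one], mul_smul, mul_smul, hst, hst, hst]
    · rw [h2b] at hsum; exact absurd hsum hb0
    · exact hst
    · rw [show σ ^ 4 = σ ^ 2 * σ ^ 2 by rw [← pow_add], mul_smul, h2b, h2b] at hsum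
      exact absurd hsum hb0
    · have : σ ^ 3 = σ ^ 5 * σ ^ 5 * σ ^ 5 := by
        rw [← pow_add, ← pow_add, show 5 + 5 + 5 = 6 + (6 + 3) from rfl, pow_add, pow_add, h6]; simp
      rw [this, mul_smul, mul_smul, hst, hst, hst]
  obtain ⟨m, rfl⟩ := hfe
  refine D.HG_stable hQ0 hst3 ((p ^ m : ℕ) : 𝓞 K) ?_ ?_
  · rw [hf, Ideal.span_singleton_pow, pow_add]; congr 2; push_cast; ring
  · rw [gsmul_natCast, hf, pow_add]; push_cast; ring

end Dat
end

structure Ints {K : Type*} [Field K] [NumberField K] (σ : K ≃ₐ[ℚ] K) (a b w c : 𝓞 K) : Prop where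
  ha : a ^ 3 = 21 * a - 35
  hb : b ^ 2 = -7
  hw : w ^ 2 = w - 2
  hwb : 2 * w = 1 + b
  hc : c ^ 2 = 5 * a - 3 * a ^ 2
  hcb : c * b = a ^ 2
  sb : σ • b = -b
  sw : σ • w = 1 - w
  sa : (σ ^ 3) • a = a
  sc : (σ ^ 3) • c = -c
  e1 : a + σ • a + (σ ^ 2) • a = 0
  e2 : a * σ • a + a * (σ ^ 2) • a + σ • a * (σ ^ 2) • a = -21
  e3 : a * σ • a * (σ ^ 2) • a = -35

section
variable {K : Type*} [Field K] [NumberField K]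

lemma gsmul_ofNat (τ : K ≃ₐ[ℚ] K) (n : ℕ) [n.AtLeastTwo] : τ • (ofNat(n) : 𝓞 K) = ofNat(n) :=
  gsmul_natCast τ n

lemma gsmul_intCast (τ : K ≃ₐ[ℚ] K) (n : ℤ) : τ • (n : 𝓞 K) = n := by
  apply RingOfIntegers.coe_injective
  refine (gsmul_coe ..).trans ?_
  simp

lemma coe_alg (x : 𝓞 K) : algebraMap (𝓞 K) K x = (x : K) := rfl

lemma eq_of_coe {x y : 𝓞 K} (h : (x : K) = y) : x = y := RingOfIntegers.coe_injective h

lemma ofNat_coe (n : ℕ) [n.AtLeastTwo] : ((ofNat(n) : 𝓞 K) : K) = ofNat(n) :=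
  map_ofNat (algebraMap (𝓞 K) K) n

lemma add_coe (x y : 𝓞 K) : ((x + y : 𝓞 K) : K) = x + y := rfl
lemma sub_coe (x y : 𝓞 K) : ((x - y : 𝓞 K) : K) = x - y := rfl
lemma mul_coe (x y : 𝓞 K) : ((x * y : 𝓞 K) : K) = x * y := rfl
lemma neg_coe (x : 𝓞 K) : ((-x : 𝓞 K) : K) = -x := rfl
lemma one_coe : ((1 : 𝓞 K) : K) = 1 := rfl
lemma zero_coe : ((0 : 𝓞 K) : K) = 0 := rfl
lemma pow_coe (x : 𝓞 K) (n : ℕ) : ((x ^ n : 𝓞 K) : K) = x ^ n := map_pow (algebraMap (𝓞 K) K) x n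

namespace Dat
variable {σ : K ≃ₐ[ℚ] K} {α β : K} (D : Dat σ α β)
include D

lemma exists_ints : ∃ a b w c : 𝓞 K, (a : K) = α ∧ (b : K) = β ∧ Ints σ a b w c := by
  have hβ := D.hβ
  have hα := D.hα
  have hβ0 : β ≠ 0 := by rintro rfl; norm_num at hβ
  have sβ := D.sβ
  have sα := D.sα
  have i1 : IsIntegral ℤ α := by
    refine ⟨Polynomial.X ^ 3 - Polynomial.C 21 * Polynomial.X + Polynomial.C 35, ?_, ?_⟩
    · monicity!
    · simp [hα]
  have i2 : IsIntegral ℤ ((1 + β) / 2) := by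
    refine ⟨Polynomial.X ^ 2 - Polynomial.X + Polynomial.C 2, ?_, ?_⟩
    · monicity!
    · simp
      linear_combination hβ / 4
  have i3 : IsIntegral ℤ (α ^ 2 / β) := by
    apply IsIntegral.of_pow (n := 2) (by norm_num)
    have : (α ^ 2 / β) ^ 2 = 5 * α - 3 * α ^ 2 := by
      field_simp
      rw [hβ]; linear_combination α * hα
    rw [this]
    have h5 : IsIntegral ℤ (5 : K) := by simpa using isIntegral_algebraMap (R := ℤ) (A := K) (x := 5)
    have h3 : IsIntegral ℤ (3 : K) := by simpa using isIntegral_algebraMap (R := ℤ) (A := K) (x := 3)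
    exact (h5.mul i1).sub (h3.mul (i1.pow 2))
  obtain ⟨a, ha⟩ := exists_int i1
  obtain ⟨w, hw⟩ := exists_int i2
  obtain ⟨c, hc⟩ := exists_int i3
  obtain ⟨b, hb, hb2, hσb⟩ := D.exists_beta
  have s2 : (σ ^ 2) α = σ (σ α) := rfl
  have s3 : (σ ^ 3) α = σ (σ (σ α)) := rfl
  have t3 : (σ ^ 3) β = σ (σ (σ β)) := rfl
  refine ⟨a, b, w, c, ha, hb, ⟨?_, hb2, ?_, ?_, ?_, ?_, hσb, ?_, ?_, ?_, ?_, ?_, ?_⟩⟩ <;>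
    apply eq_of_coe <;>
    simp only [add_coe, sub_coe, mul_coe, neg_coe, one_coe, zero_coe, pow_coe, ofNat_coe, gsmul_coe, ha, hb, hw, hc]
  · exact hα
  · linear_combination hβ / 4
  · field_simp
  · field_simp
    rw [hβ]; linear_combination α * hα
  · field_simp
  · rw [map_div₀, map_add, map_one, sβ, map_ofNat σ 2]
    field_simp; ring
  · rw [s3, sα]
  · rw [map_div₀, map_pow, s3, sα, t3, sβ, map_neg, sβ, neg_neg, sβ, div_neg]
  · rw [s2]; exact D.e1
  · rw [s2]; exact D.e2
  · rw [s2]; exact D.e3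

variable {a b w c : 𝓞 K} (H : Ints σ a b w c)

def _root_.NF (A0 A1 A2 : ℤ) : ℤ := A0^3+42*A0^2*A2-21*A0*A1^2+105*A0*A1*A2+441*A0*A2^2-35*A1^3+735*A1*A2^2+1225*A2^3

include H

lemma norm_of [IsGalois ℚ K] {x : 𝓞 K} (A0 A1 A2 : ℤ)
    (h : x * (σ ^ 3) • x = A0 + A1 * a + A2 * a ^ 2) : Algebra.norm ℤ x = NF A0 A1 A2 := by
  have h1 := D.prod_norm x
  rw [D.prod_gal] at h1
  have h2 : (1 : K ≃ₐ[ℚ] K) • x * σ • x * (σ ^ 2) • x * (σ ^ 3) • x * (σ ^ 4) • x * (σ ^ 5) • x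
    = (x * (σ ^ 3) • x) * σ • (x * (σ ^ 3) • x) * (σ ^ 2) • (x * (σ ^ 3) • x) := by
    simp only [smul_mul', smul_smul, ← pow_add, ← pow_succ', one_smul]
    ring
  rw [h2, h] at h1
  simp only [smul_add, smul_mul', smul_pow', gsmul_intCast] at h1
  have : ((Algebra.norm ℤ x : ℤ) : 𝓞 K) = ((NF A0 A1 A2 : ℤ) : 𝓞 K) := by
    rw [← h1]
    have e1 := H.e1
    have e2 := H.e2
    have e3 := H.e3
    generalize σ • a = r at *
    generalize (σ ^ 2) • a = s at *
    have hs : s = - a - r := by linear_combination e1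
    subst hs
    simp only [NF]; push_cast
    have e2' : a ^ 2 + a * r + r ^ 2 = 21 := by linear_combination -e2
    have e3' : a ^ 2 * r + a * r ^ 2 = 35 := by linear_combination -e3
    have k1 : r ^ 2 = 21 - a ^ 2 - a * r := by linear_combination e2'
    have k2 : a ^ 3 = 21 * a - 35 := H.ha
    have id : (A0 + A1 * a + A2 * a ^ 2) * (A0 + A1 * r + A2 * r ^ 2) * (A0 + A1 * (-a-r) + A2 * (-a-r) ^ 2)
      = (A0:𝓞 K)^3+2*(a ^ 2 + a * r + r ^ 2)*A0^2*A2-(a ^ 2 + a * r + r ^ 2)*A0*A1^2+3*(a ^ 2 * r + a * r ^ 2)*A0*A1*A2+(a ^ 2 + a * r + r ^ 2)^2*A0*A2^2-(a ^ 2 * r + a * r ^ 2)*A1^3+(a ^ 2 * r + a * r ^ 2)*(a ^ 2 + a * r + r ^ 2)*A1*A2^2+(a ^ 2 * r + a * r ^ 2)^2*A2^3 := by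
      ring
    rw [id, e2', e3']
    ring
  exact_mod_cast this

omit H in
lemma orbit [IsGalois ℚ K] {Q Q' : Ideal (𝓞 K)} (hQ : Q.IsPrime) (hQ' : Q'.IsPrime) {p : ℕ} (hp : p.Prime)
    (h : (p : 𝓞 K) ∈ Q) (h' : (p : 𝓞 K) ∈ Q') : ∃ i : ℕ, (σ ^ i) • Q = Q' := by
  haveI : Q.LiesOver (Ideal.span {(p : ℤ)}) := ⟨liesOver_of_mem hQ hp h⟩
  haveI : Q'.LiesOver (Ideal.span {(p : ℤ)}) := ⟨liesOver_of_mem hQ' hp h'⟩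
  obtain ⟨τ, hτ⟩ := Ideal.exists_smul_eq_of_isGaloisGroup (Ideal.span {(p : ℤ)}) Q Q' (K ≃ₐ[ℚ] K)
  obtain ⟨i, -, rfl⟩ := D.exists_pow τ
  exact ⟨i, hτ⟩

omit H in
lemma good_of_one [IsGalois ℚ K] {Q : Ideal (𝓞 K)} (hQ : Q.IsPrime) {p : ℕ} (hp : p.Prime)
    (h : (p : 𝓞 K) ∈ Q) (hg : HG σ Q) : good σ p := by
  intro Q' hQ' h'
  obtain ⟨i, rfl⟩ := D.orbit hQ hQ' hp h h'
  exact HG_smul_pow hg i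

omit D H in
lemma _root_.exists_prime_mem {Q : Ideal (𝓞 K)} (hQ : Q.IsPrime) {m : ℕ} (hm0 : m ≠ 0)
    (hmem : (m : 𝓞 K) ∈ Q) : ∃ q : ℕ, q.Prime ∧ q ∣ m ∧ (q : 𝓞 K) ∈ Q := by
  induction m using induction_on_primes with
  | zero => exact absurd rfl hm0
  | one => exact absurd ((Ideal.eq_top_iff_one _).mpr (by simpa using hmem)) hQ.ne_top
  | prime_mul p n hp ih =>
    rw [Nat.cast_mul] at hmem
    rcases hQ.mem_or_mem hmem with h | h
    · exact ⟨p, hp, dvd_mul_right _ _, h⟩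
    · obtain ⟨q, hq, hqn, hqQ⟩ := ih (by rintro rfl; simp at hm0) h
      exact ⟨q, hq, hqn.mul_left _, hqQ⟩

omit D H in
lemma _root_.exists_factor {x : 𝓞 K} {p m : ℕ} (hp : p.Prime) (hm : ¬ p ∣ m)
    (hx : Algebra.norm ℤ x = p * m) : ∃ Q J : Ideal (𝓞 K), Q.IsPrime ∧ (p : 𝓞 K) ∈ Q ∧
    Ideal.span {x} = Q * J ∧ Ideal.absNorm Q = p ∧ Ideal.absNorm J = m := by
  have hN : Ideal.absNorm (Ideal.span {x}) = p * m := by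
    rw [Ideal.absNorm_span_singleton, hx]; exact_mod_cast Int.natAbs_natCast (p * m)
  obtain ⟨Q, hQ, hu, J, hJ⟩ := Ideal.exists_isMaximal_dvd_of_dvd_absNorm' hp (Ideal.span {x}) (by rw [hN]; exact dvd_mul_right _ _)
  have hpQ : (p : 𝓞 K) ∈ Q := by
    have : (p : ℤ) ∈ Q.under ℤ := by rw [hu]; exact Ideal.mem_span_singleton_self _
    rw [Ideal.under_def, Ideal.mem_comap] at this
    simpa using this
  obtain ⟨f, hf0, hf⟩ := absNorm_prime_pow hQ.isPrime hp hpQ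
  rw [hJ, map_mul, hf] at hN
  have hf1 : f = 1 := by
    by_contra hne
    obtain ⟨g, rfl⟩ : ∃ g, f = g + 2 := ⟨f - 2, by omega⟩
    apply hm
    have : p * (p * (p ^ g * Ideal.absNorm J)) = p * m := by rw [← hN]; ring
    exact ⟨_, (Nat.eq_of_mul_eq_mul_left hp.pos this).symm⟩
  subst hf1
  rw [pow_one] at hN hf
  exact ⟨Q, J, hQ.isPrime, hpQ, hJ, hf, Nat.eq_of_mul_eq_mul_left hp.pos hN⟩

omit H in
lemma good_split [IsGalois ℚ K] {x : 𝓞 K} {p m : ℕ} (hp : p.Prime) (hm : ¬ p ∣ m)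
    (hx : Algebra.norm ℤ x = p * m) (hg : ∀ q : ℕ, q.Prime → q ∣ m → good σ q) : good σ p := by
  obtain ⟨Q, J, hQ, hpQ, hJ, hNQ, hNJ⟩ := exists_factor hp hm hx
  have hm0 : m ≠ 0 := by rintro rfl; simp at hm
  apply D.good_of_one hQ hp hpQ
  refine HG_cancel (J := J) ?_ ?_ ?_
  · rintro rfl
    simp at hNJ; exact hm0 hNJ.symm
  · rw [← hJ]; exact D.HG_span x
  · apply D.HG_of_primes
    intro Q' hQ' _ hdvd
    have hmem : (m : 𝓞 K) ∈ Q' := by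
      rw [← hNJ]
      exact Ideal.dvd_iff_le.mp hdvd (Ideal.absNorm_mem J)
    obtain ⟨q, hq, hqm, hqQ⟩ := exists_prime_mem hQ' hm0 hmem
    exact hg q hq hqm Q' hQ' hqQ

end Dat
end

def inertList : List ℕ := [2,29,37,43,53,67,79,107,109,113,163,179,191,193,211,233,239,281,317,331]
def splitList : List ℕ := [7,2,11,23,71,127,137,149,151,197,263,277]

lemma inertList_noroot : ∀ p ∈ inertList, ∀ n < p, (n ^ 3 + 35) % p ≠ (21 * n) % p := by
  decide +kernel

lemma prime_cases : ∀ p < 337, (p ≤ 1 ∨ ∃ d < 19, 2 ≤ d ∧ d < p ∧ p % d = 0) ∨ (p % 7 = 3 ∨ p % 7 = 5 ∨ p % 7 = 6) ∨ p ∈ splitList ∨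
    (p ∈ inertList ∧ 29 ≤ p) := by
  decide +kernel

lemma prime_cases' {p : ℕ} (hp : p.Prime) (h : p < 337) : (p % 7 = 3 ∨ p % 7 = 5 ∨ p % 7 = 6) ∨ p ∈ splitList ∨
    (p ∈ inertList ∧ 29 ≤ p) := by
  rcases prime_cases p h with (h1 | ⟨d, -, hd2, hdp, hd⟩) | h1
  · exact absurd hp.two_le (by omega)
  · exfalso
    rcases (Nat.dvd_prime hp).mp (Nat.dvd_of_mod_eq_zero hd) with h | h <;> omega
  · exact h1

section
variable {K : Type*} [Field K] [NumberField K]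

namespace Dat
variable {σ : K ≃ₐ[ℚ] K} {α β : K} (D : Dat σ α β)
variable {a b w c : 𝓞 K} (H : Ints σ a b w c)
include H

lemma _root_.Ints.s3b : (σ ^ 3) • b = -b := by
  rw [pow_succ, pow_succ, pow_one, mul_smul, mul_smul, H.sb, smul_neg, H.sb, neg_neg, H.sb]

lemma _root_.Ints.s3w : (σ ^ 3) • w = 1 - w := by
  rw [pow_succ, pow_succ, pow_one, mul_smul, mul_smul, H.sw, smul_sub, H.sw, smul_one, sub_sub_cancel, H.sw]

lemma no_root {J : Ideal (𝓞 K)} {p : ℕ} (hp : p ∈ inertList) (hpp : p.Prime) : Ideal.absNorm J ≠ p := by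
  intro hN
  have hJ : J ≠ ⊤ := by
    intro h
    rw [← Ideal.absNorm_eq_one_iff, hN] at h
    exact hpp.one_lt.ne' h
  have hpJ : (p : 𝓞 K) ∈ J := by rw [← hN]; exact Ideal.absNorm_mem J
  obtain ⟨n, hn⟩ := int_rep hpp hN a
  have h1 : ((n ^ 3 - 21 * n + 35 : ℤ) : 𝓞 K) ∈ J := by
    have := J.mul_mem_left (-(a ^ 2 + a * n + n ^ 2 - 21)) hn
    convert this using 1
    push_cast
    linear_combination H.ha
  have h2 := dvd_of_mem hJ hpp hpJ h1
  have hp0 : (0 : ℤ) < p := by exact_mod_cast hpp.pos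
  apply inertList_noroot p hp (n % p).toNat
  · have := Int.emod_lt_of_pos n hp0
    have := Int.emod_nonneg n hp0.ne'
    omega
  · have h3 : (n ^ 3 + 35) ≡ 21 * n [ZMOD p] := by
      apply Int.ModEq.symm
      rw [Int.modEq_iff_dvd]
      convert h2 using 1; ring
    have h4 : ((n % p).toNat : ℤ) ≡ n [ZMOD p] := by
      rw [Int.toNat_of_nonneg (Int.emod_nonneg n hp0.ne')]
      exact Int.mod_modEq n p
    have h5 : (((n % p).toNat ^ 3 + 35 : ℕ) : ℤ) ≡ ((21 * (n % p).toNat : ℕ) : ℤ) [ZMOD p] := by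
      push_cast
      exact ((h4.pow 3).add_right 35).trans (h3.trans (h4.mul_left 21).symm)
    exact (Int.natCast_modEq_iff.mp h5)

include D

lemma norm_natCast [IsGalois ℚ K] (n : ℕ) : Ideal.absNorm (Ideal.span {(n : 𝓞 K)}) = n ^ 6 := by
  rw [Ideal.absNorm_span_singleton, D.norm_of H (n ^ 2) 0 0]
  · simp only [NF]
    have : ((n : ℤ) ^ 2) ^ 3 + 42 * ((n : ℤ) ^ 2) ^ 2 * 0 - 21 * (n : ℤ) ^ 2 * 0 ^ 2 + 105 * (n : ℤ) ^ 2 * 0 * 0 +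
      441 * (n : ℤ) ^ 2 * 0 ^ 2 - 35 * 0 ^ 3 + 735 * 0 * 0 ^ 2 + 1225 * 0 ^ 3 = ((n ^ 6 : ℕ) : ℤ) := by
      push_cast; ring
    rw [this, Int.natAbs_natCast]
  · rw [gsmul_natCast]; push_cast; ring

lemma exists_P7 [IsGalois ℚ K] : ∃ P : Ideal (𝓞 K), P.IsPrime ∧ Ideal.absNorm P = 7 ∧
    P ^ 6 = Ideal.span {(7 : 𝓞 K)} := by
  have hx : Algebra.norm ℤ c = (7 : ℕ) * (625 : ℕ) := by
    rw [D.norm_of H 0 (-5) 3]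
    · norm_num [NF]
    · rw [H.sc]; push_cast; linear_combination -H.hc
  obtain ⟨P, J, hP, h7, hJ, hN, -⟩ := exists_factor (by norm_num) (by norm_num) hx
  refine ⟨P, hP, hN, ?_⟩
  have hcP : c ∈ P := by
    have : c ∈ Ideal.span {c} := Ideal.mem_span_singleton_self c
    rw [hJ] at this
    exact Ideal.dvd_iff_le.mp (dvd_mul_right P J) this
  have hbP : b ∈ P := by
    apply hP.mem_of_pow_mem 2
    rw [H.hb]; exact P.neg_mem (by exact_mod_cast h7)
  have haP : a ∈ P := by
    apply hP.mem_of_pow_mem 2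
    rw [← H.hcb]; exact P.mul_mem_left _ hbP
  have p2 : ∀ {x : 𝓞 K}, x ∈ P → x ^ 2 ∈ P ^ 2 := fun h => Ideal.pow_mem_pow h 2
  have h72 : (7 : 𝓞 K) ∈ P ^ 2 := by
    have := (P ^ 2).neg_mem (p2 hbP)
    rw [H.hb] at this; simpa using this
  have ha2 : a ∈ P ^ 2 := by
    have h1 := (P ^ 2).mul_mem_left 3 (p2 hcP)
    have h2 := (P ^ 2).mul_mem_left 9 (p2 haP)
    have h3 := (P ^ 2).mul_mem_left (2 * a) h72
    have := (P ^ 2).sub_mem ((P ^ 2).add_mem h1 h2) h3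
    convert this using 1
    linear_combination -3 * H.hc
  have ha6 : a ^ 3 ∈ P ^ 6 := by
    have := Ideal.pow_mem_pow ha2 3
    rwa [← pow_mul] at this
  have h4 : ∀ {n m : ℕ} {x y : 𝓞 K}, x ∈ P ^ n → y ∈ P ^ m → x * y ∈ P ^ (n + m) := by
    intro n m x y hx hy
    rw [pow_add]; exact Ideal.mul_mem_mul hx hy
  have h74 : (7 : 𝓞 K) ∈ P ^ 4 := by
    have k1 := (P ^ 4).mul_mem_left 9 (h4 h72 ha2)
    have k2 := (P ^ 4).mul_mem_left 3 (Ideal.pow_le_pow_right (by norm_num : 4 ≤ 6) ha6)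
    have k3 := (P ^ 4).mul_mem_left 2 (h4 h72 h72)
    have := (P ^ 4).sub_mem ((P ^ 4).sub_mem k1 k2) k3
    convert this using 1
    linear_combination 3 * H.ha
  have h76 : (7 : 𝓞 K) ∈ P ^ 6 := by
    have k1 := (P ^ 6).mul_mem_left 9 (h4 h74 ha2)
    have k2 := (P ^ 6).mul_mem_left 3 ha6
    have k3 := (P ^ 6).mul_mem_left 2 (h4 h74 h72)
    have := (P ^ 6).sub_mem ((P ^ 6).sub_mem k1 k2) k3
    convert this using 1
    linear_combination 3 * H.ha
  have hdvd : P ^ 6 ∣ Ideal.span {(7 : 𝓞 K)} := by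
    rw [Ideal.dvd_iff_le, Ideal.span_singleton_le_iff_mem]; exact h76
  obtain ⟨R, hR⟩ := hdvd
  have hNN := D.norm_natCast H 7
  rw [Nat.cast_ofNat, hR, map_mul, map_pow, hN] at hNN
  have : Ideal.absNorm R = 1 := by
    exact Nat.eq_of_mul_eq_mul_left (by norm_num : 0 < 7 ^ 6) (by rw [hNN]; norm_num)
  rw [Ideal.absNorm_eq_one_iff] at this
  rw [hR, this, Ideal.mul_top]

lemma P7_stable {P : Ideal (𝓞 K)} (hP6 : P ^ 6 = Ideal.span {(7 : 𝓞 K)}) (τ : K ≃ₐ[ℚ] K) : τ • P = P := by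
  apply ideal_pow_inj (n := 6) (by norm_num)
  rw [← smul_pow', hP6, gsmul_span, gsmul_ofNat]

lemma good_7 [IsGalois ℚ K] : good σ 7 := by
  obtain ⟨P, hP, hN, hP6⟩ := D.exists_P7 H
  have h7 : ((7 : ℕ) : 𝓞 K) ∈ P := by rw [← hN]; exact Ideal.absNorm_mem P
  refine D.good_of_one hP (by norm_num) h7 ?_
  refine D.HG_stable (ne_bot_of_mem (by norm_num) h7) (D.P7_stable H hP6 _) b ?_ ?_
  · rw [Ideal.span_singleton_pow, H.hb, Ideal.span_singleton_neg, hN]; norm_num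
  · rw [H.s3b, hN]; push_cast; linear_combination -H.hb

lemma good_2 [IsGalois ℚ K] : good σ 2 := by
  have key : ∀ π : 𝓞 K, π * (σ ^ 3) • π = 2 → ∀ Q : Ideal (𝓞 K), Q.IsPrime → ((2 : ℕ) : 𝓞 K) ∈ Q → π ∈ Q → HG σ Q := by
    intro π hπ Q hQ h2 hm
    have hN : Ideal.absNorm (Ideal.span {π}) = 8 := by
      rw [Ideal.absNorm_span_singleton, D.norm_of H 2 0 0]
      · norm_num [NF]
      · rw [hπ]; push_cast; ring
    have hdvd : Q ∣ Ideal.span {π} := by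
      rw [Ideal.dvd_iff_le, Ideal.span_singleton_le_iff_mem]; exact hm
    obtain ⟨J, hJ⟩ := hdvd
    rw [hJ, map_mul] at hN
    obtain ⟨f, hf0, hf⟩ := absNorm_prime_pow hQ Nat.prime_two h2
    have i1 : Ideal.absNorm Q ≠ 2 := no_root H (by simp [inertList]) Nat.prime_two
    have i2 : Ideal.absNorm J ≠ 2 := no_root H (by simp [inertList]) Nat.prime_two
    rw [hf] at hN i1
    have hf3 : f ≤ 3 := by
      by_contra hlt
      have : 2 ^ 4 ∣ 8 := (pow_dvd_pow 2 (by omega : 4 ≤ f)).trans ⟨_, hN.symm⟩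
      norm_num at this
    have hJ1 : Ideal.absNorm J = 1 := by
      interval_cases f <;> omega
    rw [Ideal.absNorm_eq_one_iff] at hJ1
    rw [hJ1, Ideal.mul_top] at hJ
    rw [← hJ]; exact D.HG_span π
  intro Q hQ h2
  have hmem : w * (1 - w) ∈ Q := by
    convert h2 using 1
    push_cast; linear_combination -H.hw
  rcases hQ.mem_or_mem hmem with h | h
  · exact key w (by rw [H.s3w]; linear_combination -H.hw) Q hQ h2 h
  · exact key (1 - w) (by rw [smul_sub, smul_one, H.s3w]; linear_combination -H.hw) Q hQ h2 h

lemma norm_uv [IsGalois ℚ K] (u0 u1 u2 v0 v1 v2 A0 A1 A2 : ℤ) (N : ℤ)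
    (h : ((u0 + u1 * a + u2 * a ^ 2) ^ 2 + (u0 + u1 * a + u2 * a ^ 2) * (v0 + v1 * a + v2 * a ^ 2) + 2 * (v0 + v1 * a + v2 * a ^ 2) ^ 2 : 𝓞 K)
      = A0 + A1 * a + A2 * a ^ 2) (hN : NF A0 A1 A2 = N) :
    Algebra.norm ℤ ((u0 + u1 * a + u2 * a ^ 2 : 𝓞 K) + (v0 + v1 * a + v2 * a ^ 2) * w) = N := by
  rw [← hN]
  apply D.norm_of H
  simp only [smul_add, smul_mul', smul_pow', gsmul_intCast, H.sa, H.s3w]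
  rw [← h]
  linear_combination -(v0 + v1 * a + v2 * a ^ 2 : 𝓞 K) ^ 2 * H.hw

omit D H in
lemma _root_.good_of_list {l : List ℕ} {m : ℕ} (hl : l.prod = m) (h : ∀ q ∈ l, q.Prime ∧ good σ q) :
    ∀ q : ℕ, q.Prime → q ∣ m → good σ q := by
  intro q hq hqm
  rw [← hl] at hqm
  obtain ⟨r, hr, hqr⟩ := (Nat.Prime.prime hq).dvd_prod_iff.mp hqm
  rw [(Nat.prime_dvd_prime_iff_eq hq (h r hr).1).mp hqr]
  exact (h r hr).2

lemma norm11 [IsGalois ℚ K] : ∃ x : 𝓞 K, Algebra.norm ℤ x = (11 : ℕ) * (49 : ℕ) := by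
  have ha := H.ha
  exact ⟨_, D.norm_uv H (-1) 0 0 2 (-1) 0 7 (-7) 2 _ (by push_cast; ring) (by norm_num [NF])⟩

lemma good_11 [IsGalois ℚ K] : good σ 11 := by
  obtain ⟨x, hx⟩ := D.norm11 H
  refine D.good_split (by norm_num) (by norm_num) hx (good_of_list (l := [7, 7]) (by norm_num) ?_)
  have := D.good_7 H
  simp [this]; norm_num

lemma good_3 [IsGalois ℚ K] : good σ 3 := D.good_nonsplit (by norm_num) (by norm_num)

lemma good_23 [IsGalois ℚ K] : good σ 23 := by
  have h3 := D.good_3 H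
  have h7 := D.good_7 H
  have hx := D.norm_uv H (-3) (0) (0) (-1) (1) (0) (14) (-7) (2) ((23 : ℕ) * (441 : ℕ))
    (by push_cast; linear_combination (0 + 0 * a) * H.ha) (by norm_num [NF])
  refine D.good_split (by norm_num) (by norm_num) hx (good_of_list (l := [3, 3, 7, 7]) (by norm_num) ?_)
  simp only [List.mem_cons, List.not_mem_nil, or_false, forall_eq_or_imp, forall_eq]
  norm_num [h3, h7]

lemma good_71 [IsGalois ℚ K] : good σ 71 := by
  have h7 := D.good_7 H
  have h11 := D.good_11 H
  have hx := D.norm_uv H (-1) (0) (0) (2) (1) (0) (7) (7) (2) ((71 : ℕ) * (539 : ℕ))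
    (by push_cast; linear_combination (0 + 0 * a) * H.ha) (by norm_num [NF])
  refine D.good_split (by norm_num) (by norm_num) hx (good_of_list (l := [7, 7, 11]) (by norm_num) ?_)
  simp only [List.mem_cons, List.not_mem_nil, or_false, forall_eq_or_imp, forall_eq]
  norm_num [h7, h11]

lemma good_127 [IsGalois ℚ K] : good σ 127 := by
  have h11 := D.good_11 H
  have h23 := D.good_23 H
  have hx := D.norm_uv H (0) (-1) (0) (-3) (0) (0) (18) (3) (1) ((127 : ℕ) * (253 : ℕ))
    (by push_cast; linear_combination (0 + 0 * a) * H.ha) (by norm_num [NF])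
  refine D.good_split (by norm_num) (by norm_num) hx (good_of_list (l := [11, 23]) (by norm_num) ?_)
  simp only [List.mem_cons, List.not_mem_nil, or_false, forall_eq_or_imp, forall_eq]
  norm_num [h11, h23]

lemma good_137 [IsGalois ℚ K] : good σ 137 := by
  have h23 := D.good_23 H
  have hx := D.norm_uv H (0) (-1) (0) (-1) (0) (0) (2) (1) (1) ((137 : ℕ) * (23 : ℕ))
    (by push_cast; linear_combination (0 + 0 * a) * H.ha) (by norm_num [NF])
  refine D.good_split (by norm_num) (by norm_num) hx (good_of_list (l := [23]) (by norm_num) ?_)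
  simp only [List.mem_cons, List.not_mem_nil, or_false, forall_eq_or_imp, forall_eq]
  norm_num [h23]

lemma good_149 [IsGalois ℚ K] : good σ 149 := by
  have h11 := D.good_11 H
  have hx := D.norm_uv H (-1) (0) (0) (-1) (1) (0) (4) (-5) (2) ((149 : ℕ) * (11 : ℕ))
    (by push_cast; linear_combination (0 + 0 * a) * H.ha) (by norm_num [NF])
  refine D.good_split (by norm_num) (by norm_num) hx (good_of_list (l := [11]) (by norm_num) ?_)
  simp only [List.mem_cons, List.not_mem_nil, or_false, forall_eq_or_imp, forall_eq]
  norm_num [h11]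

lemma good_151 [IsGalois ℚ K] : good σ 151 := by
  have h11 := D.good_11 H
  have h23 := D.good_23 H
  have hx := D.norm_uv H (-1) (0) (1) (0) (-1) (0) (36) (-55) (21) ((151 : ℕ) * (5819 : ℕ))
    (by push_cast; linear_combination (-1 + 1 * a) * H.ha) (by norm_num [NF])
  refine D.good_split (by norm_num) (by norm_num) hx (good_of_list (l := [11, 23, 23]) (by norm_num) ?_)
  simp only [List.mem_cons, List.not_mem_nil, or_false, forall_eq_or_imp, forall_eq]
  norm_num [h11, h23]

lemma good_197 [IsGalois ℚ K] : good σ 197 := by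
  have h11 := D.good_11 H
  have h23 := D.good_23 H
  have hx := D.norm_uv H (-1) (1) (0) (0) (1) (0) (1) (-3) (4) ((197 : ℕ) * (253 : ℕ))
    (by push_cast; linear_combination (0 + 0 * a) * H.ha) (by norm_num [NF])
  refine D.good_split (by norm_num) (by norm_num) hx (good_of_list (l := [11, 23]) (by norm_num) ?_)
  simp only [List.mem_cons, List.not_mem_nil, or_false, forall_eq_or_imp, forall_eq]
  norm_num [h11, h23]

lemma good_263 [IsGalois ℚ K] : good σ 263 := by
  have h11 := D.good_11 H
  have h23 := D.good_23 H
  have hx := D.norm_uv H (0) (0) (-1) (-1) (1) (0) (37) (-60) (24) ((263 : ℕ) * (5819 : ℕ))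
    (by push_cast; linear_combination (-1 + 1 * a) * H.ha) (by norm_num [NF])
  refine D.good_split (by norm_num) (by norm_num) hx (good_of_list (l := [11, 23, 23]) (by norm_num) ?_)
  simp only [List.mem_cons, List.not_mem_nil, or_false, forall_eq_or_imp, forall_eq]
  norm_num [h11, h23]

lemma good_277 [IsGalois ℚ K] : good σ 277 := by
  have h11 := D.good_11 H
  have hx := D.norm_uv H (0) (-1) (0) (1) (-1) (0) (2) (-5) (4) ((277 : ℕ) * (121 : ℕ))
    (by push_cast; linear_combination (0 + 0 * a) * H.ha) (by norm_num [NF])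
  refine D.good_split (by norm_num) (by norm_num) hx (good_of_list (l := [11, 11]) (by norm_num) ?_)
  simp only [List.mem_cons, List.not_mem_nil, or_false, forall_eq_or_imp, forall_eq]
  norm_num [h11]

lemma HG_small [IsGalois ℚ K] {Q : Ideal (𝓞 K)} (hQ : Q.IsPrime) (hQ0 : Q ≠ ⊥)
    (hN : Ideal.absNorm Q ≤ 336) : HG σ Q := by
  have hN0 : Ideal.absNorm Q ≠ 0 := by rwa [Ne, Ideal.absNorm_eq_zero_iff]
  obtain ⟨p, hp, hpd, hpQ⟩ := exists_prime_mem hQ hN0 (Ideal.absNorm_mem Q)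
  have hple : p < 337 := lt_of_le_of_lt (Nat.le_of_dvd (Nat.pos_of_ne_zero hN0) hpd) (by omega)
  rcases prime_cases' hp hple with h | h | ⟨h, h29⟩
  · exact D.good_nonsplit hp h Q hQ hpQ
  · have : good σ p := by
      simp only [splitList, List.mem_cons, List.not_mem_nil, or_false] at h
      rcases h with rfl | rfl | rfl | rfl | rfl | rfl | rfl | rfl | rfl | rfl | rfl | rfl
      · exact D.good_7 H
      · exact D.good_2 H
      · exact D.good_11 H
      · exact D.good_23 H
      · exact D.good_71 H
      · exact D.good_127 H
      · exact D.good_137 H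
      · exact D.good_149 H
      · exact D.good_151 H
      · exact D.good_197 H
      · exact D.good_263 H
      · exact D.good_277 H
    exact this Q hQ hpQ
  · exfalso
    obtain ⟨f, hf0, hf⟩ := absNorm_prime_pow hQ hp hpQ
    have hf1 : f = 1 := by
      by_contra hne
      have : p ^ 2 ≤ p ^ f := Nat.pow_le_pow_right hp.pos (by omega)
      nlinarith
    rw [hf1, pow_one] at hf
    exact no_root H h hp hf

end Dat
end

section
variable {K : Type*} [Field K] [NumberField K]

namespace Dat
variable {σ : K ≃ₐ[ℚ] K} {α β : K} (D : Dat σ α β)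
include D

lemma tr_zero (hdeg : Module.finrank ℚ K = 6) (q : ℚ) : Algebra.trace ℚ K (algebraMap ℚ K q) = 6 * q := by
  rw [Algebra.trace_algebraMap, hdeg]; simp

lemma tr_one : Algebra.trace ℚ K α = 0 := by
  have h := congrArg (Algebra.trace ℚ K) D.e1
  rw [map_add, map_add, Algebra.trace_eq_of_algEquiv, Algebra.trace_eq_of_algEquiv,
    Algebra.trace_eq_of_algEquiv, map_zero] at h
  linarith

lemma tr_two (hdeg : Module.finrank ℚ K = 6) : Algebra.trace ℚ K (α ^ 2) = 84 := by
  have h0 : α ^ 2 + σ (α ^ 2) + σ (σ (α ^ 2)) = algebraMap ℚ K 42 := by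
    simp only [map_pow]
    rw [map_ofNat (algebraMap ℚ K) 42]
    linear_combination (α + σ α + σ (σ α)) * D.e1 - 2 * D.e2
  have h := congrArg (Algebra.trace ℚ K) h0
  rw [map_add, map_add, Algebra.trace_eq_of_algEquiv, Algebra.trace_eq_of_algEquiv,
    Algebra.trace_eq_of_algEquiv, D.tr_zero hdeg] at h
  linarith

lemma tr_three (hdeg : Module.finrank ℚ K = 6) : Algebra.trace ℚ K (α ^ 3) = -210 := by
  have : α ^ 3 = (21 : ℚ) • α - algebraMap ℚ K 35 := by
    rw [D.hα, Algebra.smul_def, map_ofNat (algebraMap ℚ K) 21, map_ofNat (algebraMap ℚ K) 35]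
  rw [this, map_sub, map_smul, D.tr_one, D.tr_zero hdeg]; norm_num

lemma tr_four (hdeg : Module.finrank ℚ K = 6) : Algebra.trace ℚ K (α ^ 4) = 1764 := by
  have : α ^ 4 = (21 : ℚ) • α ^ 2 - (35 : ℚ) • α := by
    rw [Algebra.smul_def, Algebra.smul_def, map_ofNat (algebraMap ℚ K) 21, map_ofNat (algebraMap ℚ K) 35]
    linear_combination α * D.hα
  rw [this, map_sub, map_smul, map_smul, D.tr_one, D.tr_two hdeg]; norm_num

lemma tr_beta (k : ℕ) : Algebra.trace ℚ K (α ^ k * β) = 0 := by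
  have h := Algebra.trace_eq_of_algEquiv (σ ^ 3) (α ^ k * β)
  have s3 : (σ ^ 3) α = σ (σ (σ α)) := rfl
  have t3 : (σ ^ 3) β = σ (σ (σ β)) := rfl
  rw [map_mul, map_pow, s3, t3, D.sα, D.sβ, map_neg, D.sβ, neg_neg, D.sβ, mul_neg, map_neg] at h
  linarith

lemma tr_beta2 (k : ℕ) : Algebra.trace ℚ K (α ^ k * β ^ 2) = -7 * Algebra.trace ℚ K (α ^ k) := by
  have : α ^ k * β ^ 2 = (-7 : ℚ) • α ^ k := by
    rw [D.hβ, Algebra.smul_def, map_neg, map_ofNat (algebraMap ℚ K) 7]; ring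
  rw [this, map_smul]; rfl

omit D in
def _root_.uu (α β : K) : Fin 3 ⊕ Fin 3 → K := Sum.elim (fun i => α ^ (i : ℕ)) (fun i => α ^ (i : ℕ) * β)

omit D in
def _root_.MM : Matrix (Fin 3) (Fin 3) ℚ := !![6, 0, 84; 0, 84, -210; 84, -210, 1764]

lemma trMat (hdeg : Module.finrank ℚ K = 6) :
    Algebra.traceMatrix ℚ (uu α β) = Matrix.fromBlocks MM 0 0 ((-7 : ℚ) • MM) := by
  have h0 : ∀ i j : Fin 3, Algebra.trace ℚ K (α ^ (i : ℕ) * α ^ (j : ℕ)) = MM i j := by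
    intro i j
    rw [← pow_add]
    have t0 := D.tr_zero hdeg 1
    rw [map_one] at t0
    fin_cases i <;> fin_cases j <;>
    simp [MM, t0, D.tr_one, D.tr_two hdeg, D.tr_three hdeg, D.tr_four hdeg]
  ext i j
  rw [Algebra.traceMatrix_apply, Algebra.traceForm_apply]
  rcases i with i | i <;> rcases j with j | j <;> simp only [uu, Sum.elim_inl, Sum.elim_inr,
    Matrix.fromBlocks_apply₁₁, Matrix.fromBlocks_apply₁₂, Matrix.fromBlocks_apply₂₁, Matrix.fromBlocks_apply₂₂,
    Matrix.zero_apply, Matrix.smul_apply]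
  · exact h0 i j
  · rw [← mul_assoc, ← pow_add, D.tr_beta]
  · rw [mul_right_comm, ← pow_add, D.tr_beta]
  · rw [show α ^ (i : ℕ) * β * (α ^ (j : ℕ) * β) = α ^ ((i : ℕ) + (j : ℕ)) * β ^ 2 by ring, D.tr_beta2, ← h0, pow_add]
    rfl

lemma discr_uu (hdeg : Module.finrank ℚ K = 6) : Algebra.discr ℚ (uu α β) = -343 * 31752 ^ 2 := by
  rw [Algebra.discr_def, D.trMat hdeg, Matrix.det_fromBlocks_zero₂₁, Matrix.det_smul]
  simp [MM, Matrix.det_fin_three]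
  norm_num

omit D in
def _root_.PP : Matrix (Fin 3 ⊕ Fin 3) (Fin 3 ⊕ Fin 3) ℚ :=
  Matrix.fromBlocks 1 ((1 / 2 : ℚ) • 1) 0 (Matrix.diagonal ![1 / 2, 1 / 2, 1 / 14])

variable {a b w c : 𝓞 K} (H : Ints σ a b w c)

lemma discr_bound (ha : (a : K) = α) (hb : (b : K) = β) (H : Ints σ a b w c) (hdeg : Module.finrank ℚ K = 6) :
    |discr K| ≤ 7 * 63 ^ 4 := by
  let v : Fin 3 ⊕ Fin 3 → 𝓞 K := Sum.elim (fun i => a ^ (i : ℕ)) ![w, a * w, c * (w - 1)]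
  have hβ0 : β ≠ 0 := by
    have hβ := D.hβ
    rintro rfl; norm_num at hβ
  have hw : (w : K) = (1 + β) / 2 := by
    have := congrArg (fun x : 𝓞 K => (x : K)) H.hwb
    simp only [mul_coe, add_coe, one_coe, ofNat_coe, hb] at this
    field_simp; linear_combination this
  have hc : (c : K) = α ^ 2 / β := by
    have := congrArg (fun x : 𝓞 K => (x : K)) H.hcb
    simp only [mul_coe, pow_coe, hb, ha] at this
    field_simp; linear_combination this
  have hv : (fun i => (v i : K)) = Matrix.vecMul (uu α β) (PP.map (algebraMap ℚ K)) := by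
    funext i
    rw [Matrix.vecMul, dotProduct, Fintype.sum_sum_type, Fin.sum_univ_three, Fin.sum_univ_three]
    rcases i with i | i <;> fin_cases i <;>
      simp [v, uu, PP, pow_coe, mul_coe, sub_coe, one_coe, ha, hw, hc]
    · ring
    · ring
    · field_simp
      linear_combination (-2 * α ^ 2) * D.hβ
  have h1 : Algebra.discr ℚ (fun i => (v i : K)) = (1 / 56) ^ 2 * (-343 * 31752 ^ 2) := by
    rw [hv, Algebra.discr_of_matrix_vecMul, D.discr_uu hdeg, PP, Matrix.det_fromBlocks_zero₂₁]
    simp [Fin.prod_univ_three]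
    norm_num
  have h2 : ((Algebra.discr ℤ v : ℤ) : ℚ) = Algebra.discr ℚ (fun i => (v i : K)) := by
    rw [Algebra.discr_def, Algebra.discr_def]
    rw [show ((Algebra.traceMatrix ℤ v).det : ℚ) = (Int.castRingHom ℚ) (Algebra.traceMatrix ℤ v).det from rfl,
      RingHom.map_det]
    congr 1
    ext i j
    simp only [RingHom.mapMatrix_apply, Matrix.map_apply, Algebra.traceMatrix_apply, Algebra.traceForm_apply]
    exact Algebra.coe_trace_int (v i * v j)
  have hcard : Fintype.card (Module.Free.ChooseBasisIndex ℤ (𝓞 K)) = Fintype.card (Fin 3 ⊕ Fin 3) := by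
    rw [← Module.finrank_eq_card_chooseBasisIndex, RingOfIntegers.rank, hdeg]; simp
  let B := (RingOfIntegers.basis K).reindex (Fintype.equivOfCardEq hcard)
  have h3 : Algebra.discr ℤ v = (B.toMatrix v).det ^ 2 * discr K := by
    rw [← discr_eq_discr K B, ← Algebra.discr_of_matrix_vecMul, Module.Basis.toMatrix_map_vecMul]
  have h4 : (B.toMatrix v).det ^ 2 * discr K = -(7 * 63 ^ 4) := by
    rw [← h3]
    have : ((Algebra.discr ℤ v : ℤ) : ℚ) = ((-(7 * 63 ^ 4) : ℤ) : ℚ) := by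
      rw [h2, h1]; norm_num
    exact_mod_cast this
  have h5 := congrArg abs h4
  rw [abs_mul, abs_neg, abs_of_nonneg (by norm_num : (0 : ℤ) ≤ 7 * 63 ^ 4), abs_of_nonneg (sq_nonneg _)] at h5
  have h6 : 1 ≤ (B.toMatrix v).det ^ 2 := by
    have : (B.toMatrix v).det ≠ 0 := by
      intro h
      rw [h] at h5; norm_num at h5
    have := sq_nonneg (B.toMatrix v).det
    have : (B.toMatrix v).det ^ 2 ≠ 0 := by positivity
    omega
  rw [← h5]
  exact le_mul_of_one_le_left (abs_nonneg _) h6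

lemma HG_all [IsGalois ℚ K] (hdeg : Module.finrank ℚ K = 6) {I : Ideal (𝓞 K)} (hI : I ≠ ⊥) : HG σ I := by
  obtain ⟨a, b, w, c, ha, hb, H⟩ := D.exists_ints
  have hd := D.discr_bound ha hb H hdeg
  let I0 : nonZeroDivisors (Ideal (𝓞 K)) := ⟨I, mem_nonZeroDivisors_of_ne_zero hI⟩
  obtain ⟨J, hJ, hJN⟩ := exists_ideal_in_class_of_norm_le (ClassGroup.mk0 I0)
  rw [hdeg] at hJN
  have hbd : (Ideal.absNorm (J : Ideal (𝓞 K)) : ℝ) < 337 := by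
    refine lt_of_le_of_lt hJN ?_
    have hr := InfinitePlace.card_add_two_mul_card_eq_rank K
    rw [hdeg] at hr
    have hr2 : InfinitePlace.nrComplexPlaces K ≤ 3 := by omega
    have hpi := Real.pi_gt_d2
    have hpi4 := Real.pi_le_four
    have hpos := Real.pi_pos
    have k1 : (4 / Real.pi) ^ InfinitePlace.nrComplexPlaces K ≤ (4 / 3.14) ^ 3 := by
      calc (4 / Real.pi) ^ InfinitePlace.nrComplexPlaces K ≤ (4 / Real.pi) ^ 3 :=
            pow_le_pow_right₀ (by rw [le_div_iff₀ hpos]; linarith) hr2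
        _ ≤ (4 / 3.14) ^ 3 := by gcongr
    have k2 : √|((discr K : ℤ) : ℝ)| ≤ 10501 := by
      rw [Real.sqrt_le_left (by norm_num)]
      have : |((discr K : ℤ) : ℝ)| ≤ 7 * 63 ^ 4 := by exact_mod_cast hd
      linarith
    calc _ ≤ (4 / 3.14 : ℝ) ^ 3 * (((6 : ℕ).factorial : ℝ) / ((6 : ℕ) : ℝ) ^ 6 * 10501) := by gcongr
      _ < 337 := by norm_num [Nat.factorial]
  have hbd' : Ideal.absNorm (J : Ideal (𝓞 K)) ≤ 336 := by
    have : Ideal.absNorm (J : Ideal (𝓞 K)) < 337 := by exact_mod_cast hbd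
    omega
  have hJ0 : (J : Ideal (𝓞 K)) ≠ ⊥ := nonZeroDivisors.coe_ne_zero J
  have hJN0 : Ideal.absNorm (J : Ideal (𝓞 K)) ≠ 0 := by rwa [Ne, Ideal.absNorm_eq_zero_iff]
  have hHG : HG σ (J : Ideal (𝓞 K)) := by
    apply D.HG_of_primes
    intro Q hQ hQ0 hdvd
    refine D.HG_small H hQ hQ0 ?_
    have h := Ideal.absNorm_dvd_absNorm_of_le (Ideal.dvd_iff_le.mp hdvd)
    exact (Nat.le_of_dvd (Nat.pos_of_ne_zero hJN0) h).trans hbd'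
  obtain ⟨x, y, hx, hy, hxy⟩ := ClassGroup.mk0_eq_mk0_iff.mp hJ
  exact D.HG_class hy hxy.symm hHG

end Dat
end

section
variable {K : Type*} [Field K] [NumberField K]

lemma fermat {Q : Ideal (𝓞 K)} (hQ : Q.IsPrime) {q : ℕ} (hN : Ideal.absNorm Q = q) (hq : q ≠ 0)
    {z : 𝓞 K} (hz : z ∉ Q) : z ^ (q - 1) - 1 ∈ Q := by
  have hQ0 : Q ≠ ⊥ := by rintro rfl; simp at hN; exact hq hN.symm
  haveI := hQ.isMaximal hQ0
  letI := Ideal.Quotient.field Q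
  haveI : Finite (𝓞 K ⧸ Q) := Ideal.finiteQuotientOfFreeOfNeBot Q hQ0
  letI := Fintype.ofFinite (𝓞 K ⧸ Q)
  have hcard : Fintype.card (𝓞 K ⧸ Q) = q := by
    rw [← hN, Ideal.absNorm_apply, Submodule.cardQuot_apply, Nat.card_eq_fintype_card]
  have h := FiniteField.pow_card_sub_one_eq_one (Ideal.Quotient.mk Q z)
    (by rwa [Ne, Ideal.Quotient.eq_zero_iff_mem])
  rw [hcard] at h
  rw [← Ideal.Quotient.eq, map_pow, h, map_one]

lemma ell {Q : Ideal (𝓞 K)} (hQ : Q.IsPrime) {q : ℕ} (hN : Ideal.absNorm Q = q) (hq : q.Prime)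
    {z : 𝓞 K} {l : ℕ} (hl : l.Prime) (hz : z ^ l = 1) (hz1 : z ≠ 1) : l ∣ q - 1 ∨ l = q := by
  by_contra! hcon
  obtain ⟨h1, h2⟩ := hcon
  have hqQ : (q : 𝓞 K) ∈ Q := by rw [← hN]; exact Ideal.absNorm_mem Q
  have hzQ : z ∉ Q := by
    intro h
    apply hQ.ne_top
    rw [Ideal.eq_top_iff_one, ← hz]
    exact Q.pow_mem_of_mem h l hl.pos
  have hf := fermat hQ hN hq.ne_zero hzQ
  rw [← Ideal.Quotient.eq, map_pow, map_one] at hf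
  have hl' : (Ideal.Quotient.mk Q z) ^ l = 1 := by rw [← map_pow, hz, map_one]
  have hone : Ideal.Quotient.mk Q z = 1 := by
    rw [← orderOf_eq_one_iff]
    have hd1 := orderOf_dvd_of_pow_eq_one hf
    have hd2 := orderOf_dvd_of_pow_eq_one hl'
    have hc : Nat.Coprime l (q - 1) := (Nat.Prime.coprime_iff_not_dvd hl).mpr h1
    exact Nat.eq_one_of_dvd_coprimes hc hd2 hd1
  have hs : ∑ i ∈ Finset.range l, z ^ i = 0 := by
    have := mul_geom_sum z l
    rw [hz, sub_self] at this
    rcases mul_eq_zero.mp this with h | h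
    · exact absurd (sub_eq_zero.mp h) hz1
    · exact h
  have hlQ : (l : 𝓞 K) ∈ Q := by
    have := congrArg (Ideal.Quotient.mk Q) hs
    rw [map_sum] at this
    simp only [map_pow, hone, one_pow, Finset.sum_const, Finset.card_range, map_zero, nsmul_eq_mul, mul_one] at this
    rw [← Ideal.Quotient.eq_zero_iff_mem, map_natCast]
    exact this
  have := dvd_of_mem hQ.ne_top hq hqQ (n := l) (by exact_mod_cast hlQ)
  exact h2 ((Nat.prime_dvd_prime_iff_eq hq hl).mp (Int.natCast_dvd_natCast.mp this)).symm

lemma two_not_mem {P : Ideal (𝓞 K)} (hP : P.IsPrime) (hN : Ideal.absNorm P = 7) : (2 : 𝓞 K) ∉ P := by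
  intro h
  have h7 : ((7 : ℕ) : 𝓞 K) ∈ P := by rw [← hN]; exact Ideal.absNorm_mem P
  have := dvd_of_mem hP.ne_top (by norm_num : Nat.Prime 7) h7 (n := 2) (by exact_mod_cast h)
  norm_num at this

namespace Dat
variable {σ : K ≃ₐ[ℚ] K} {α β : K} (D : Dat σ α β)
include D

lemma unit_pm [IsGalois ℚ K] {u : 𝓞 K} (hu : u * (σ ^ 3) • u = 1) : u = 1 ∨ u = -1 := by
  obtain ⟨a, b, w, c, ha, hb, H⟩ := D.exists_ints
  obtain ⟨P, hP, hN, hP6⟩ := D.exists_P7 H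
  obtain ⟨x, hx⟩ := D.norm11 H
  obtain ⟨Q, -, hQ, -, -, hNQ, -⟩ := exists_factor (by norm_num) (by norm_num) hx
  have hodd : ∀ z : 𝓞 K, ∀ l : ℕ, l.Prime → Odd l → z ^ l = 1 → z = 1 := by
    intro z l hl hlo hz
    by_contra hz1
    have h1 := ell hP hN (by norm_num) hl hz hz1
    have h2 := ell hQ hNQ (by norm_num) hl hz hz1
    norm_num at h1 h2
    have hle : l ≤ 7 := by
      rcases h1 with h | h
      · exact (Nat.le_of_dvd (by norm_num) h).trans (by norm_num)
      · omega
    interval_cases l <;> revert hl hlo <;> revert h1 h2 <;> decide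
  have h4 : ∀ z : 𝓞 K, z ^ 2 ≠ -1 := by
    intro z hz
    have hzP : z ∉ P := by
      intro h
      apply hP.ne_top
      rw [Ideal.eq_top_iff_one, ← neg_neg (1 : 𝓞 K), ← hz]
      exact P.neg_mem (P.pow_mem_of_mem h 2 (by norm_num))
    have hf := fermat hP hN (by norm_num) hzP
    rw [show 7 - 1 = 2 * 3 from rfl, pow_mul, hz] at hf
    apply two_not_mem hP hN
    convert P.neg_mem hf using 1
    norm_num
  have hfin : ∃ n : ℕ, 0 < n ∧ u ^ n = 1 := by
    obtain ⟨n, hn, h⟩ := Embeddings.pow_eq_one_of_norm_eq_one K ℂ (x := (u : K))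
      (RingOfIntegers.isIntegral_coe u) (by
        intro φ
        have h1 := D.conj_eq φ (u : K)
        have h2 : (u : K) * (σ ^ 3) (u : K) = 1 := by
          have := congrArg (fun x : 𝓞 K => (x : K)) hu
          simpa only [mul_coe, gsmul_coe, one_coe] using this
        have h3 := congrArg φ h2
        rw [map_mul, ← h1, map_one] at h3
        have h4 := congrArg norm h3
        rw [norm_mul, norm_star, norm_one] at h4
        nlinarith [_root_.norm_nonneg (φ (u : K))])
    exact ⟨n, hn, eq_of_coe (by rw [pow_coe, h, one_coe])⟩
  have hof : IsOfFinOrder u := isOfFinOrder_iff_pow_eq_one.mpr hfin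
  have hpos := hof.orderOf_pos
  rcases Nat.eq_two_pow_or_exists_odd_prime_and_dvd (orderOf u) with ⟨e, he⟩ | ⟨l, hl, ⟨m, hm⟩, hlo⟩
  · have hu1 := pow_orderOf_eq_one u
    rcases Nat.lt_or_ge e 2 with h | h
    · have : u ^ 2 = 1 := by
        rw [← orderOf_dvd_iff_pow_eq_one, he]
        exact pow_dvd_pow 2 (show e ≤ 1 by omega)
      exact sq_eq_one_iff.mp this
    · exfalso
      obtain ⟨f, rfl⟩ : ∃ f, e = f + 2 := ⟨e - 2, by omega⟩
      have h5 : (u ^ 2 ^ (f + 1)) ^ 2 = 1 := by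
        rw [← pow_mul, ← pow_succ, ← he]; exact hu1
      have h6 : u ^ 2 ^ (f + 1) ≠ 1 := by
        intro h
        have := orderOf_dvd_of_pow_eq_one h
        rw [he] at this
        have := (Nat.pow_dvd_pow_iff_le_right (by norm_num : 1 < 2)).mp this
        omega
      rcases sq_eq_one_iff.mp h5 with h | h
      · exact h6 h
      · apply h4 (u ^ 2 ^ f)
        rw [← pow_mul, ← pow_succ]; exact h
  · exfalso
    have h1 : (u ^ m) ^ l = 1 := by
      rw [← pow_mul, mul_comm, ← hm]; exact pow_orderOf_eq_one u
    have h2 := hodd _ l hl hlo h1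
    have h3 := orderOf_dvd_of_pow_eq_one h2
    have hm0 : 0 < m := by
      rcases Nat.eq_zero_or_pos m with h | h
      · rw [h, mul_zero] at hm; omega
      · exact h
    have := Nat.le_of_dvd hm0 h3
    rw [hm] at this
    have := hl.two_le
    nlinarith

end Dat
end

section
variable {K : Type*} [Field K] [NumberField K]

lemma idealConj_eq (τ : K ≃ₐ[ℚ] K) (I : Ideal (𝓞 K)) : idealConj τ I = τ • I := by
  rw [idealConj, Ideal.pointwise_smul_def]
  have : ((galRestrict ℤ ℚ K (𝓞 K) τ : 𝓞 K ≃ₐ[ℤ] 𝓞 K) : 𝓞 K →+* 𝓞 K) = MulSemiringAction.toRingHom (K ≃ₐ[ℚ] K) (𝓞 K) τ := by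
    ext x
    have : galRestrict ℤ ℚ K (𝓞 K) τ x = τ • x := by
      apply RingOfIntegers.coe_injective
      rw [algebraMap_galRestrict_apply]; rfl
    exact congrArg (fun y : 𝓞 K => (y : K)) this
  rw [← this]; rfl

/-- Data of the prime above 7. -/
structure P7 (P : Ideal (𝓞 K)) : Prop where
  pr : P.IsPrime
  nm : Ideal.absNorm P = 7
  p6 : P ^ 6 = Ideal.span {(7 : 𝓞 K)}

def Cand (σ : K ≃ₐ[ℚ] K) (P I : Ideal (𝓞 K)) (γ : 𝓞 K) : Prop :=
  Ideal.span {γ} = PhiI σ I ∧ γ * (σ ^ 3) • γ = (Ideal.absNorm I : 𝓞 K) ∧ γ ^ 3 - 1 ∈ P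

lemma sub_one_mul_mem {P : Ideal (𝓞 K)} {x y : 𝓞 K} (hx : x - 1 ∈ P) (hy : y - 1 ∈ P) : x * y - 1 ∈ P := by
  have := P.add_mem (P.mul_mem_left x hy) hx
  convert this using 1; ring

lemma P7.stable {P : Ideal (𝓞 K)} (h : P7 P) (τ : K ≃ₐ[ℚ] K) : τ • P = P := by
  apply ideal_pow_inj (n := 6) (by norm_num)
  rw [← smul_pow', h.p6, gsmul_span, gsmul_ofNat]

lemma P7.smul_mem {P : Ideal (𝓞 K)} (h : P7 P) (τ : K ≃ₐ[ℚ] K) {x : 𝓞 K} (hx : x ∈ P) : τ • x ∈ P := by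
  have := Ideal.smul_mem_pointwise_smul τ x P hx
  rwa [h.stable] at this

lemma P7.smul_sub_one {P : Ideal (𝓞 K)} (h : P7 P) (τ : K ≃ₐ[ℚ] K) {x : 𝓞 K} (hx : x - 1 ∈ P) : τ • x - 1 ∈ P := by
  have := h.smul_mem τ hx
  rwa [smul_sub, smul_one] at this

lemma P7.seven {P : Ideal (𝓞 K)} (h : P7 P) : (7 : 𝓞 K) ∈ P := by
  have : ((Ideal.absNorm P : ℕ) : 𝓞 K) ∈ P := Ideal.absNorm_mem P
  rw [h.nm] at this; exact_mod_cast this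

lemma P7.not_le {P I : Ideal (𝓞 K)} (h : P7 P) (hI : IsCoprime I (Ideal.span {(7 : 𝓞 K)})) : ¬ I ≤ P := by
  intro hle
  rw [Ideal.isCoprime_iff_sup_eq] at hI
  apply h.pr.ne_top
  rw [eq_top_iff, ← hI]
  exact sup_le hle ((Ideal.span_singleton_le_iff_mem _).mpr h.seven)

lemma Cand.mul {σ : K ≃ₐ[ℚ] K} {P I J : Ideal (𝓞 K)} {γ δ : 𝓞 K} (h1 : Cand σ P I γ) (h2 : Cand σ P J δ) :
    Cand σ P (I * J) (γ * δ) := by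
  obtain ⟨a1, b1, c1⟩ := h1
  obtain ⟨a2, b2, c2⟩ := h2
  refine ⟨?_, ?_, ?_⟩
  · rw [PhiI_mul, ← a1, ← a2, Ideal.span_singleton_mul_span_singleton]
  · rw [map_mul, Nat.cast_mul, ← b1, ← b2, smul_mul']; ring
  · rw [mul_pow]; exact sub_one_mul_mem c1 c2

namespace Dat
variable {σ : K ≃ₐ[ℚ] K} {α β : K} (D : Dat σ α β)
include D

lemma cand_exists [IsGalois ℚ K] (hdeg : Module.finrank ℚ K = 6) {P : Ideal (𝓞 K)} (hP : P7 P) {I : Ideal (𝓞 K)}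
    (hI : I ≠ ⊥) (hI7 : IsCoprime I (Ideal.span {(7 : 𝓞 K)})) : ∃ γ, Cand σ P I γ := by
  obtain ⟨γ, h1, h2⟩ := D.HG_all hdeg hI
  have hle := hP.not_le hI7
  have hst : ∀ τ : K ≃ₐ[ℚ] K, ¬ τ • I ≤ P := by
    intro τ h
    rw [← hP.stable τ, Ideal.pointwise_smul_le_pointwise_smul_iff] at h
    exact hle h
  have hγ : γ ∉ P := by
    rw [← Ideal.span_singleton_le_iff_mem, h1, PhiI, hP.pr.mul_le, hP.pr.mul_le]
    rintro ((h | h) | h)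
    · exact hle h
    · exact hst _ h
    · exact hst _ h
  have hf := fermat hP.pr hP.nm (by norm_num) hγ
  have : (γ ^ 3 - 1) * (γ ^ 3 + 1) ∈ P := by
    convert hf using 1; ring
  rcases hP.pr.mem_or_mem this with h | h
  · exact ⟨γ, h1, h2, h⟩
  · refine ⟨-γ, ?_, ?_, ?_⟩
    · rw [Ideal.span_singleton_neg, h1]
    · rw [smul_neg, neg_mul_neg, h2]
    · convert P.neg_mem h using 1; ring

lemma cand_unique [IsGalois ℚ K] {P : Ideal (𝓞 K)} (hP : P7 P) {I : Ideal (𝓞 K)}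
    (hI : I ≠ ⊥) {γ δ : 𝓞 K} (h1 : Cand σ P I γ) (h2 : Cand σ P I δ) : γ = δ := by
  obtain ⟨a1, b1, c1⟩ := h1
  obtain ⟨a2, b2, c2⟩ := h2
  obtain ⟨u, hu⟩ := Ideal.span_singleton_eq_span_singleton.mp (a1.trans a2.symm)
  have hN : (Ideal.absNorm I : 𝓞 K) ≠ 0 := by
    have : Ideal.absNorm I ≠ 0 := by rwa [Ne, Ideal.absNorm_eq_zero_iff]
    exact_mod_cast this
  have hu1 : (u : 𝓞 K) * (σ ^ 3) • (u : 𝓞 K) = 1 := by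
    apply mul_left_cancel₀ hN
    rw [mul_one]
    conv_rhs => rw [← b2, ← hu, smul_mul']
    rw [← b1]; ring
  rcases D.unit_pm hu1 with h | h
  · rw [← hu, h, mul_one]
  · exfalso
    rw [h] at hu
    rw [← hu] at c2
    apply two_not_mem hP.pr hP.nm
    convert P.neg_mem (P.add_mem c1 c2) using 1; ring

lemma cand_smul [IsGalois ℚ K] {P : Ideal (𝓞 K)} (hP : P7 P) {I : Ideal (𝓞 K)}
    {γ : 𝓞 K} (h1 : Cand σ P I γ) : Cand σ P (σ • I) (σ • γ) := by
  obtain ⟨a1, b1, c1⟩ := h1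
  refine ⟨?_, ?_, ?_⟩
  · rw [← gsmul_span, a1, smul_PhiI]
  · rw [absNorm_gsmul, ← gsmul_natCast σ, ← b1, smul_mul', smul_smul, smul_smul, ← pow_succ, ← pow_succ']
  · rw [← smul_pow']; exact hP.smul_sub_one σ c1

lemma cand_span [IsGalois ℚ K] {P : Ideal (𝓞 K)} (hP : P7 P) {s : 𝓞 K} (hs : s - 1 ∈ P) :
    Cand σ P (Ideal.span {s}) (phiE σ s) := by
  refine ⟨(PhiI_span σ s).symm, D.absNorm_span_cast s, ?_⟩
  have h : phiE σ s - 1 ∈ P :=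
    sub_one_mul_mem (sub_one_mul_mem hs (hP.smul_sub_one _ hs)) (hP.smul_sub_one _ hs)
  rw [pow_succ, sq]
  exact sub_one_mul_mem (sub_one_mul_mem h h) h

/-- ideals stable under complex conjugation with square norm -/
lemma cand_stable [IsGalois ℚ K] {P : Ideal (𝓞 K)} {I : Ideal (𝓞 K)} (hI : I ≠ ⊥)
    (hst : (σ ^ 3) • I = I) {n : ℕ} (hn : Ideal.absNorm I = n ^ 2) (ε : ℤ) (hε : ε ^ 2 = 1)
    (h : (ε * (n : 𝓞 K)) ^ 3 - 1 ∈ P) : Cand σ P I (ε * n) := by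
  have hε' : (ε : 𝓞 K) ^ 2 = 1 := by exact_mod_cast hε
  refine ⟨?_, ?_, h⟩
  · have h := D.PhiI_mul_conj hI
    apply ideal_pow_inj two_ne_zero
    have e : (σ ^ 3) • PhiI σ I = PhiI σ I := by
      simp only [PhiI, smul_mul', smul_smul, ← pow_add, hst]
      rw [add_comm 3 4, add_comm 3 5, pow_add, pow_add, mul_smul, mul_smul, hst]
    rw [e, hn] at h
    rw [sq (PhiI σ I), h, Ideal.span_singleton_pow, mul_pow, hε', one_mul]
    push_cast; rfl
  · rw [smul_mul', gsmul_intCast, gsmul_natCast, hn]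
    push_cast; linear_combination (n : 𝓞 K) ^ 2 * hε'

end Dat
end

section
variable {K : Type*} [Field K] [NumberField K]

/-- Extension of an ideal from the cubic subfield. -/
noncomputable abbrev ext3 (σ : K ≃ₐ[ℚ] K) (p : Ideal (𝓞 (cubicFixedField σ))) : Ideal (𝓞 K) :=
  Ideal.map (algebraMap (𝓞 (cubicFixedField σ)) (𝓞 K)) p

lemma fix_alg (σ : K ≃ₐ[ℚ] K) (e : 𝓞 (cubicFixedField σ)) :
    (σ ^ 3) • algebraMap (𝓞 (cubicFixedField σ)) (𝓞 K) e = algebraMap (𝓞 (cubicFixedField σ)) (𝓞 K) e := by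
  apply eq_of_coe
  rw [gsmul_coe]
  have h : ((algebraMap (𝓞 (cubicFixedField σ)) (𝓞 K) e : 𝓞 K) : K) = ((e : cubicFixedField σ) : K) := rfl
  rw [h]
  have := (e : cubicFixedField σ).2
  exact this ⟨σ ^ 3, Subgroup.mem_zpowers _⟩

lemma ext3_stable (σ : K ≃ₐ[ℚ] K) (p : Ideal (𝓞 (cubicFixedField σ))) : (σ ^ 3) • ext3 σ p = ext3 σ p := by
  rw [Ideal.pointwise_smul_def, ext3, Ideal.map_map]
  congr 1
  apply RingHom.ext
  intro e
  exact fix_alg σ e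

lemma ext3_ne_bot (σ : K ≃ₐ[ℚ] K) {p : Ideal (𝓞 (cubicFixedField σ))} (hp : p ≠ ⊥) : ext3 σ p ≠ ⊥ := by
  exact Ideal.map_ne_bot_of_ne_bot hp

lemma comap_eq (σ : K ≃ₐ[ℚ] K) {p : Ideal (𝓞 (cubicFixedField σ))} (hpp : p.IsPrime) (hp : p ≠ ⊥)
    {Q : Ideal (𝓞 K)} (hQ : Q ≠ ⊤) (h : ext3 σ p ≤ Q) :
    Q.comap (algebraMap (𝓞 (cubicFixedField σ)) (𝓞 K)) = p := by
  have hm : p.IsMaximal := hpp.isMaximal hp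
  symm
  apply hm.eq_of_le (Ideal.comap_ne_top _ hQ)
  exact Ideal.map_le_iff_le_comap.mp h

lemma card_le (σ : K ≃ₐ[ℚ] K) {p : Ideal (𝓞 (cubicFixedField σ))} (hpp : p.IsPrime) (hp : p ≠ ⊥)
    {Q : Ideal (𝓞 K)} (hQ : Q ≠ ⊤) (hQ0 : Q ≠ ⊥) (h : ext3 σ p ≤ Q) :
    Ideal.absNorm p ≤ Ideal.absNorm Q := by
  have hc := comap_eq σ hpp hp hQ h
  rw [Ideal.absNorm_apply, Submodule.cardQuot_apply, Ideal.absNorm_apply, Submodule.cardQuot_apply]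
  haveI : Finite (𝓞 K ⧸ Q) := Ideal.finiteQuotientOfFreeOfNeBot Q hQ0
  exact Nat.card_le_card_of_injective _ (Ideal.quotientMap_injective' (J := p) (I := Q) (f := algebraMap _ _) (H := hc.ge) hc.le)

namespace Dat
variable {σ : K ≃ₐ[ℚ] K} {α β : K} (D : Dat σ α β)
include D

lemma finrank_two : Module.finrank (𝓞 (cubicFixedField σ)) (𝓞 K) = 2 := by
  have h1 : Module.finrank (cubicFixedField σ) K = 2 := by
    rw [cubicFixedField, IntermediateField.finrank_fixedField_eq_card, Nat.card_zpowers, orderOf_pow, D.ord]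
    norm_num
  rw [← h1]
  exact (Algebra.IsAlgebraic.finrank_of_isFractionRing (𝓞 (cubicFixedField σ)) (cubicFixedField σ) (𝓞 K) K).symm

lemma absNorm_ext3 (p : Ideal (𝓞 (cubicFixedField σ))) : Ideal.absNorm (ext3 σ p) = Ideal.absNorm p ^ 2 := by
  rw [ext3, Ideal.absNorm_algebraMap, D.finrank_two]

lemma cand_split [IsGalois ℚ K] (hdeg : Module.finrank ℚ K = 6) {P : Ideal (𝓞 K)} (hP : P7 P)
    {p : Ideal (𝓞 (cubicFixedField σ))} (hpp : p.IsPrime) (hp : p ≠ ⊥)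
    (h7 : IsCoprime (ext3 σ p) (Ideal.span {(7 : 𝓞 K)})) {Q₁ Q₂ : Ideal (𝓞 K)}
    (h1 : Q₁.IsPrime) (h2 : Q₂.IsPrime) (h : ext3 σ p = Q₁ * Q₂) :
    Cand σ P (ext3 σ p) (((1 : ℤ) : 𝓞 K) * (Ideal.absNorm p : ℕ)) := by
  have hI := ext3_ne_bot σ hp
  have l1 : ext3 σ p ≤ Q₁ := by rw [h]; exact Ideal.dvd_iff_le.mp (dvd_mul_right _ _)
  have l2 : ext3 σ p ≤ Q₂ := by rw [h]; exact Ideal.dvd_iff_le.mp (dvd_mul_left _ _)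
  have n1 : Q₁ ≠ ⊥ := fun e => hI (le_bot_iff.mp (e ▸ l1))
  have n2 : Q₂ ≠ ⊥ := fun e => hI (le_bot_iff.mp (e ▸ l2))
  have c1 := card_le σ hpp hp h1.ne_top n1 l1
  have c2 := card_le σ hpp hp h2.ne_top n2 l2
  have hN := D.absNorm_ext3 p
  rw [h, map_mul] at hN
  have hp0 : 0 < Ideal.absNorm p := Nat.pos_of_ne_zero (by rwa [Ne, Ideal.absNorm_eq_zero_iff])
  have e1 : Ideal.absNorm Q₁ = Ideal.absNorm p := by nlinarith
  have hc7 : IsCoprime Q₁ (Ideal.span {(7 : 𝓞 K)}) := by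
    rw [h] at h7; exact h7.of_mul_left_left
  obtain ⟨γ, _, b, c⟩ := D.cand_exists hdeg hP n1 hc7
  refine D.cand_stable hI (ext3_stable σ p) (D.absNorm_ext3 p) 1 (by norm_num) ?_
  rw [Int.cast_one, one_mul, ← e1, ← b, mul_pow, ← smul_pow']
  exact sub_one_mul_mem c (hP.smul_sub_one _ c)

lemma cand_inert [IsGalois ℚ K] {a b w c : 𝓞 K} (H : Ints σ a b w c) {P : Ideal (𝓞 K)} (hP : P7 P)
    {p : Ideal (𝓞 (cubicFixedField σ))} (hpp : p.IsPrime) (hp : p ≠ ⊥)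
    (h7 : IsCoprime (ext3 σ p) (Ideal.span {(7 : 𝓞 K)})) (hI : (ext3 σ p).IsPrime) :
    Cand σ P (ext3 σ p) (((-1 : ℤ) : 𝓞 K) * (Ideal.absNorm p : ℕ)) := by
  have hI0 := ext3_ne_bot σ hp
  have hst : ∀ {x : 𝓞 K}, x ∈ ext3 σ p → (σ ^ 3) • x ∈ ext3 σ p := by
    intro x hx
    have := Ideal.smul_mem_pointwise_smul (σ ^ 3) x _ hx
    rwa [ext3_stable] at this
  have h7I : (7 : 𝓞 K) ∉ ext3 σ p := by
    intro hm
    rw [Ideal.isCoprime_iff_sup_eq] at h7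
    apply hI.ne_top
    rw [eq_top_iff, ← h7]
    exact sup_le le_rfl ((Ideal.span_singleton_le_iff_mem _).mpr hm)
  have hcm := comap_eq σ hpp hp hI.ne_top le_rfl
  have hb2 : b ^ 2 ∉ ext3 σ p := by
    rw [H.hb]; intro h; apply h7I; simpa using (ext3 σ p).neg_mem h
  have h2I : (2 : 𝓞 K) ∉ ext3 σ p := by
    intro h
    have h1 : w * (1 - w) ∈ ext3 σ p := by
      convert h using 1; linear_combination -H.hw
    have key : w ∈ ext3 σ p ∧ 1 - w ∈ ext3 σ p := by
      rcases hI.mem_or_mem h1 with h | h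
      · refine ⟨h, ?_⟩
        rw [← H.s3w]; exact hst h
      · refine ⟨?_, h⟩
        have := hst h
        rw [smul_sub, smul_one, H.s3w] at this
        simpa using this
    apply hI.ne_top
    rw [Ideal.eq_top_iff_one]
    convert (ext3 σ p).add_mem key.1 key.2 using 1; ring
  -- `-7` is not a square modulo `p`
  have hns : ∀ e : 𝓞 (cubicFixedField σ), e ^ 2 + 7 ∉ p := by
    intro e he
    set E := algebraMap (𝓞 (cubicFixedField σ)) (𝓞 K) e with hE
    have hm : (E - b) * (E + b) ∈ ext3 σ p := by
      have := Ideal.mem_map_of_mem (algebraMap (𝓞 (cubicFixedField σ)) (𝓞 K)) he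
      rw [map_add, map_pow, map_ofNat (algebraMap (𝓞 (cubicFixedField σ)) (𝓞 K)) 7] at this
      convert this using 1; linear_combination -H.hb
    have f1 : (σ ^ 3) • (E - b) = E + b := by
      rw [smul_sub, H.s3b, hE, fix_alg, sub_neg_eq_add]
    have f2 : (σ ^ 3) • (E + b) = E - b := by
      rw [smul_add, H.s3b, hE, fix_alg, sub_eq_add_neg]
    have key : E - b ∈ ext3 σ p ∧ E + b ∈ ext3 σ p := by
      rcases hI.mem_or_mem hm with h | h
      · exact ⟨h, f1 ▸ hst h⟩
      · exact ⟨f2 ▸ hst h, h⟩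
    have h2b : 2 * b ∈ ext3 σ p := by
      convert (ext3 σ p).sub_mem key.2 key.1 using 1; ring
    rcases hI.mem_or_mem h2b with h | h
    · exact h2I h
    · exact hb2 ((ext3 σ p).pow_mem_of_mem h 2 (by norm_num))
  have hmem : ∀ x : 𝓞 (cubicFixedField σ), x ∈ p → algebraMap (𝓞 (cubicFixedField σ)) (𝓞 K) x ∈ ext3 σ p :=
    fun x hx => Ideal.mem_map_of_mem _ hx
  have h7p : (7 : 𝓞 (cubicFixedField σ)) ∉ p := by
    intro h
    have := hmem _ h
    rw [map_ofNat (algebraMap (𝓞 (cubicFixedField σ)) (𝓞 K)) 7] at this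
    exact h7I this
  have h2p : (2 : 𝓞 (cubicFixedField σ)) ∉ p := by
    intro h
    have := hmem _ h
    rw [map_ofNat (algebraMap (𝓞 (cubicFixedField σ)) (𝓞 K)) 2] at this
    exact h2I this
  have hnsq : ¬ IsSquare ((Ideal.absNorm p : ℕ) : ZMod 7) := by
    haveI : p.IsMaximal := hpp.isMaximal hp
    letI : Field (𝓞 (cubicFixedField σ) ⧸ p) := Ideal.Quotient.field p
    haveI : Finite (𝓞 (cubicFixedField σ) ⧸ p) := Ideal.finiteQuotientOfFreeOfNeBot p hp
    letI : Fintype (𝓞 (cubicFixedField σ) ⧸ p) := Fintype.ofFinite _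
    have hc : Fintype.card (𝓞 (cubicFixedField σ) ⧸ p) = Ideal.absNorm p := by
      rw [Ideal.absNorm_apply, Submodule.cardQuot_apply, Nat.card_eq_fintype_card]
    have q7 : (7 : 𝓞 (cubicFixedField σ) ⧸ p) ≠ 0 := by
      rw [← map_ofNat (Ideal.Quotient.mk p) 7, Ne, Ideal.Quotient.eq_zero_iff_mem]; exact h7p
    have q2 : ringChar (𝓞 (cubicFixedField σ) ⧸ p) ≠ 2 := by
      intro h
      apply h2p
      rw [← Ideal.Quotient.eq_zero_iff_mem, map_ofNat (Ideal.Quotient.mk p) 2]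
      have := ringChar.Nat.cast_ringChar (R := 𝓞 (cubicFixedField σ) ⧸ p)
      rw [h] at this
      exact_mod_cast this
    rw [← hc, ← isSquare_neg_seven_iff q2 q7]
    rintro ⟨r, hr⟩
    obtain ⟨e, rfl⟩ := Ideal.Quotient.mk_surjective r
    apply hns e
    rw [← Ideal.Quotient.eq_zero_iff_mem, map_add, map_pow, map_ofNat (Ideal.Quotient.mk p) 7]
    linear_combination -hr
  refine D.cand_stable hI0 (ext3_stable σ p) (D.absNorm_ext3 p) (-1) (by norm_num) ?_
  set N := Ideal.absNorm p
  have hz : ∀ x : ZMod 7, ¬ IsSquare x → x ^ 3 = -1 := by decide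
  have h3 := hz _ hnsq
  have h3' : ((7 : ℕ) : ℤ) ∣ (N : ℤ) ^ 3 + 1 := by
    rw [← ZMod.intCast_zmod_eq_zero_iff_dvd]
    push_cast
    rw [h3]; ring
  obtain ⟨k, hk⟩ := h3'
  have hk' : (N : 𝓞 K) ^ 3 + 1 = 7 * (k : 𝓞 K) := by exact_mod_cast congrArg (fun z : ℤ => (z : 𝓞 K)) hk
  have : (((-1 : ℤ) : 𝓞 K) * (N : 𝓞 K)) ^ 3 - 1 = 7 * (-k : 𝓞 K) := by
    push_cast; linear_combination -hk'
  rw [this]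
  exact P.mul_mem_right _ hP.seven

end Dat
end

section
variable {K : Type*} [Field K] [NumberField K]

open Classical in
/-- The ideal character. -/
noncomputable def psi (σ : K ≃ₐ[ℚ] K) (P I : Ideal (𝓞 K)) : K :=
  if h : ∃ γ, Cand σ P I γ then ((Classical.choose h : 𝓞 K) : K) else 0

lemma Dat.psi_eq [IsGalois ℚ K] {σ : K ≃ₐ[ℚ] K} {α β : K} (D : Dat σ α β) {P : Ideal (𝓞 K)} (hP : P7 P)
    {I : Ideal (𝓞 K)} (hI : I ≠ ⊥) {γ : 𝓞 K} (h : Cand σ P I γ) : psi σ P I = (γ : K) := by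
  have he : ∃ γ, Cand σ P I γ := ⟨γ, h⟩
  rw [psi, dif_pos he, D.cand_unique hP hI (Classical.choose_spec he) h]

lemma natCast_coe (n : ℕ) : ((n : 𝓞 K) : K) = n := map_natCast (algebraMap (𝓞 K) K) n

lemma Dat.final [IsGalois ℚ K] (hdeg : Module.finrank ℚ K = 6) {σ : K ≃ₐ[ℚ] K} {α β : K} (D : Dat σ α β)
    {a b w c : 𝓞 K} (H : Ints σ a b w c) {P : Ideal (𝓞 K)} (hP : P7 P) :
    IsShimuraIdealChar σ (Ideal.span {(7 : 𝓞 K)}) (psi σ P) := by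
  have ex : ∀ I : Ideal (𝓞 K), I ≠ ⊥ → IsCoprime I (Ideal.span {(7 : 𝓞 K)}) →
      ∃ γ, Cand σ P I γ ∧ psi σ P I = (γ : K) := by
    intro I hI h7
    obtain ⟨γ, hγ⟩ := D.cand_exists hdeg hP hI h7
    exact ⟨γ, hγ, D.psi_eq hP hI hγ⟩
  refine ⟨?_, ?_, ?_, ?_, ?_, ?_⟩
  · intro I hI h7 h0
    obtain ⟨γ, hγ, e⟩ := ex I hI h7
    rw [e] at h0
    have h1 : γ = 0 := eq_of_coe (h0.trans zero_coe.symm)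
    have h2 := hγ.2.1
    rw [h1, zero_mul] at h2
    have : Ideal.absNorm I ≠ 0 := by rwa [Ne, Ideal.absNorm_eq_zero_iff]
    exact this (by exact_mod_cast h2.symm)
  · intro I J hI hJ hI7 hJ7
    obtain ⟨γ, hγ, e⟩ := ex I hI hI7
    obtain ⟨δ, hδ, e'⟩ := ex J hJ hJ7
    rw [e, e', D.psi_eq hP (mul_ne_zero hI hJ) (hγ.mul hδ), mul_coe]
  · intro s _ hs
    have hsP : s - 1 ∈ P := by
      have : Ideal.span {(7 : 𝓞 K)} ≤ P := (Ideal.span_singleton_le_iff_mem _).mpr hP.seven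
      exact this hs
    have h0 : Ideal.span {s} ≠ ⊥ := by
      rw [Ne, Ideal.span_singleton_eq_bot]
      rintro rfl
      apply hP.pr.ne_top
      rw [Ideal.eq_top_iff_one]
      simpa using P.neg_mem hsP
    rw [D.psi_eq hP h0 (D.cand_span hP hsP)]
    rfl
  · intro p hpp hp h7
    have hc : Nat.card (𝓞 (cubicFixedField σ) ⧸ p) = Ideal.absNorm p := by
      rw [Ideal.absNorm_apply, Submodule.cardQuot_apply]
    rw [hc]
    refine ⟨?_, ?_⟩
    · rintro ⟨Q₁, Q₂, h1, h2, -, h⟩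
      rw [D.psi_eq hP (ext3_ne_bot σ hp) (D.cand_split hdeg hP hpp hp h7 h1 h2 h), Int.cast_one, one_mul,
        natCast_coe]
    · intro h
      rw [D.psi_eq hP (ext3_ne_bot σ hp) (D.cand_inert H hP hpp hp h7 h), Int.cast_neg, Int.cast_one,
        neg_one_mul, neg_coe, natCast_coe]
  · intro I hI h7
    obtain ⟨γ, hγ, e⟩ := ex I hI h7
    have hc : Nat.card (𝓞 K ⧸ I) = Ideal.absNorm I := by
      rw [Ideal.absNorm_apply, Submodule.cardQuot_apply]
    rw [e, hc]
    refine ⟨?_, ?_⟩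
    · rw [← natCast_coe, ← hγ.2.1, mul_coe, gsmul_coe]
    · rw [idealConj_eq, idealConj_eq]
      have h1 := hγ.1
      rw [PhiI] at h1
      rw [← h1, FractionalIdeal.coeIdeal_span_singleton]
  · intro I hI h7
    obtain ⟨γ, hγ, e⟩ := ex I hI h7
    rw [idealConj_eq, e, D.psi_eq hP (gsmul_ne_bot σ hI) (D.cand_smul hP hγ), gsmul_coe]

end

end Pieces

/-- For the sextic cyclic CM field ℚ(α, √-7) of conductor 63 there exists a Shimura ideal character. -/
theorem stmt_9 (K : Type*) [Field K] [NumberField K]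
    (hdeg : Module.finrank ℚ K = 6) [IsGalois ℚ K] (hcyc : IsCyclic (K ≃ₐ[ℚ] K))
    (α β : K) (hα : α ^ 3 = 21 * α - 35) (hβ : β ^ 2 = (-7 : K)) :
    ∃ (σ : K ≃ₐ[ℚ] K) (𝔠 : Ideal (𝓞 K)) (ψ : Ideal (𝓞 K) → K),
      (∀ τ : K ≃ₐ[ℚ] K, τ ∈ Subgroup.zpowers σ) ∧ 𝔠 ≠ ⊥ ∧
      IsShimuraIdealChar σ 𝔠 ψ := by
  obtain ⟨σ, D⟩ := exists_dat hdeg hcyc α β hα hβ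
  obtain ⟨a, b, w, c, _, _, H⟩ := D.exists_ints
  obtain ⟨P, h1, h2, h3⟩ := D.exists_P7 H
  refine ⟨σ, Ideal.span {(7 : 𝓞 K)}, psi σ P, D.gen, ?_, D.final hdeg H ⟨h1, h2, h3⟩⟩
  rw [Ne, Ideal.span_singleton_eq_bot]
  norm_num
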